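/- Fix constants d, r > 0 and h, k ∈ (0,1). Suppose c* > 0 is such that for every c ≥ 0 a semi-wave with speed c exists if and only if c < c*, and for c ∈ [0, c*) let (φ_c, ψ_c) denote the unique semi-wave with speed c. Then: (i) whenever c_i ∈ [0, c*) and c_i → ĉ ∈ [0, c*), the functions φ_{c_i} together with their first and second derivatives converge uniformly on every compact subset of [0,∞) to φ_ĉ and its derivatives, and ψ_{c_i} together with their first and second derivatives converge uniformly on every compact subset of ℝ to ψ_ĉ and its derivatives; (ii) whenever c_i ∈ [0, c*) and c_i → c*, then φ_{c_i} converges to 0 and ψ_{c_i} converges to 1, together with first and second derivatives, uniformly on every compact subset of [0,∞) and of ℝ, respectively. -/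

import Mathlib

open Real Filter Set

noncomputable def uStar (h k : ℝ) : ℝ := (1 - k) / (1 - h * k)
noncomputable def vStar (h k : ℝ) : ℝ := (1 - h) / (1 - h * k)

/-- A semi-wave with speed `c` for the system
`φ'' - cφ' + φ(1 - φ - kψ) = 0` on `(0,∞)`,
`dψ'' - cψ' + rψ(1 - ψ - hφ) = 0` on `ℝ`,
with `φ ≡ 0` on `(-∞,0]`, `ψ(-∞) = 1`, `(φ,ψ)(∞) = (u*, v*)`. -/
structure IsSemiWave (d r h k c : ℝ) (φ ψ : ℝ → ℝ) : Prop where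
  cont_phi : Continuous φ
  smooth_phi : ContDiffOn ℝ 2 φ (Set.Ici 0)
  phi_zero : ∀ s ≤ (0:ℝ), φ s = 0
  smooth_psi : ContDiff ℝ 2 ψ
  ode_phi : ∀ s > (0:ℝ),
    deriv (deriv φ) s - c * deriv φ s + φ s * (1 - φ s - k * ψ s) = 0
  phi_deriv_pos : ∀ s > (0:ℝ), 0 < deriv φ s
  ode_psi : ∀ s : ℝ,
    d * deriv (deriv ψ) s - c * deriv ψ s + r * ψ s * (1 - ψ s - h * φ s) = 0
  psi_deriv_neg : ∀ s : ℝ, deriv ψ s < 0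
  psi_atBot : Filter.Tendsto ψ Filter.atBot (nhds 1)
  phi_atTop : Filter.Tendsto φ Filter.atTop (nhds (uStar h k))
  psi_atTop : Filter.Tendsto ψ Filter.atTop (nhds (vStar h k))

/-- Data of a (possibly degenerate) solution of the semi-wave system. -/
structure PreWave (d r h k c : ℝ) (φ q ψ p : ℝ → ℝ) : Prop where
  z : ∀ s ≤ (0:ℝ), φ s = 0
  dphi : ∀ s ∈ Ici (0:ℝ), HasDerivWithinAt φ (q s) (Ici 0) s
  dq : ∀ s ∈ Ici (0:ℝ), HasDerivWithinAt q (c * q s - φ s * (1 - φ s - k * ψ s)) (Ici 0) s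
  dpsi : ∀ s : ℝ, HasDerivAt ψ (p s) s
  dp : ∀ s : ℝ, HasDerivAt p ((c * p s - r * ψ s * (1 - ψ s - h * φ s)) / d) s
  q0 : ∀ s ∈ Ici (0:ℝ), 0 ≤ q s
  p0 : ∀ s, p s ≤ 0
  phi0 : ∀ s, 0 ≤ φ s
  phi1 : ∀ s, φ s ≤ 1
  psi0 : ∀ s, vStar h k ≤ ψ s
  psi1 : ∀ s, ψ s ≤ 1

lemma star_facts {h k : ℝ} (hh : h ∈ Ioo (0:ℝ) 1) (hk : k ∈ Ioo (0:ℝ) 1) :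
    0 < uStar h k ∧ uStar h k < 1 ∧ 0 < vStar h k ∧ vStar h k < 1 ∧
    uStar h k + k * vStar h k = 1 ∧ vStar h k + h * uStar h k = 1 := by
  obtain ⟨h0, h1⟩ := hh
  obtain ⟨k0, k1⟩ := hk
  have hpos : 0 < 1 - h * k := by nlinarith
  have hne : 1 - h * k ≠ 0 := hpos.ne'
  unfold uStar vStar
  refine ⟨by apply div_pos <;> linarith, ?_, by apply div_pos <;> linarith, ?_, ?_, ?_⟩
  · rw [div_lt_one hpos]; nlinarith
  · rw [div_lt_one hpos]; nlinarith
  · rw [← mul_div_assoc, ← add_div, div_eq_one_iff_eq hne]; ring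
  · rw [← mul_div_assoc, ← add_div, div_eq_one_iff_eq hne]; ring

lemma lip_of_deriv {S : Set ℝ} (hS : Convex ℝ S) {f g : ℝ → ℝ} {L : ℝ}
    (hf : ∀ s ∈ S, HasDerivWithinAt f (g s) S s) (hg : ∀ s ∈ S, |g s| ≤ L) :
    ∀ x ∈ S, ∀ y ∈ S, |f x - f y| ≤ L * |x - y| := by
  intro x hx y hy
  exact hS.norm_image_sub_le_of_norm_hasDerivWithin_le hf hg hy hx

lemma quad_of_lip {S : Set ℝ} (hS : Convex ℝ S) {f g : ℝ → ℝ} {L : ℝ}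
    (hf : ∀ s ∈ S, HasDerivWithinAt f (g s) S s)
    (hg : ∀ x ∈ S, ∀ y ∈ S, |g x - g y| ≤ L * |x - y|) (hL : 0 ≤ L) :
    ∀ s ∈ S, ∀ t ∈ S, |f t - f s - g s * (t - s)| ≤ L * (t - s) ^ 2 := by
  intro s hs t ht
  have hsub : uIcc s t ⊆ S := by
    rw [← segment_eq_uIcc]; exact hS.segment_subset hs ht
  have key := (convex_uIcc s t).norm_image_sub_le_of_norm_hasDerivWithin_le
    (f := fun x => f x - g s * x) (f' := fun x => g x - g s) (C := L * |t - s|) (x := s) (y := t)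
    (fun x hx => by
      have h1 := ((hf x (hsub hx)).mono hsub)
      have h2 := ((hasDerivAt_id x).const_mul (g s)).hasDerivWithinAt (s := uIcc s t)
      simpa using h1.fun_sub h2)
    (fun x hx => by
      have h1 := hg x (hsub hx) s hs
      have h2 : |x - s| ≤ |t - s| := by
        exact abs_sub_left_of_mem_uIcc hx
      rw [Real.norm_eq_abs]
      exact h1.trans (mul_le_mul_of_nonneg_left h2 hL))
    left_mem_uIcc right_mem_uIcc
  rw [Real.norm_eq_abs, Real.norm_eq_abs] at key
  calc |f t - f s - g s * (t - s)| = |f t - g s * t - (f s - g s * s)| := by ring_nf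
    _ ≤ L * |t - s| * |t - s| := key
    _ = L * (t - s) ^ 2 := by rw [mul_assoc, abs_mul_abs_self]; ring

lemma hasDeriv_of_quad {S : Set ℝ} {f g : ℝ → ℝ} {L : ℝ} {s : ℝ}
    (hq : ∀ t ∈ S, |f t - f s - g s * (t - s)| ≤ L * (t - s) ^ 2) :
    HasDerivWithinAt f (g s) S s := by
  rw [hasDerivWithinAt_iff_isLittleO]
  have h1 : (fun t => f t - f s - (t - s) • g s) =O[nhdsWithin s S] (fun t => (t - s) ^ 2) := by
    apply Asymptotics.IsBigO.of_bound L
    filter_upwards [self_mem_nhdsWithin] with t ht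
    have := hq t ht
    rw [Real.norm_eq_abs, Real.norm_eq_abs, abs_of_nonneg (sq_nonneg (t - s)), smul_eq_mul, mul_comm (t - s)]
    exact this
  refine h1.trans_isLittleO ?_
  have h2 : (fun t : ℝ => (t - s) ^ 2) =o[nhds s] (fun t => t - s) := by
    have h3 : Tendsto (fun t : ℝ => t - s) (nhds s) (nhds 0) := by
      have : Continuous (fun t : ℝ => t - s) := by fun_prop
      simpa using this.tendsto s
    have := (Asymptotics.isLittleO_pow_id (𝕜 := ℝ) (n := 2) (by norm_num)).comp_tendsto h3
    simpa [Function.comp_def] using this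
  exact h2.mono nhdsWithin_le_nhds

lemma hasDeriv_limit {ι : Type*} {l : Filter ι} [l.NeBot] {S : Set ℝ}
    {F G : ι → ℝ → ℝ} {f g : ℝ → ℝ} {L : ℝ}
    (hq : ∀ i, ∀ s ∈ S, ∀ t ∈ S, |F i t - F i s - G i s * (t - s)| ≤ L * (t - s) ^ 2)
    (hF : ∀ s ∈ S, Tendsto (fun i => F i s) l (nhds (f s)))
    (hG : ∀ s ∈ S, Tendsto (fun i => G i s) l (nhds (g s))) :
    ∀ s ∈ S, HasDerivWithinAt f (g s) S s := by
  intro s hs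
  apply hasDeriv_of_quad (L := L)
  intro t ht
  refine le_of_tendsto ((((hF t ht).sub (hF s hs)).sub ((hG s hs).mul_const (t - s))).abs)
    (Eventually.of_forall fun i => hq i s hs t ht)

lemma unif_of_lip {l : Filter ℕ} {S K : Set ℝ}
    {F : ℕ → ℝ → ℝ} {f : ℝ → ℝ} {L : ℝ} (hL : 0 ≤ L) (hKc : IsCompact K) (hKS : K ⊆ S)
    (hlip : ∀ i, ∀ x ∈ S, ∀ y ∈ S, |F i x - F i y| ≤ L * |x - y|)
    (hF : ∀ s ∈ S, Tendsto (fun i => F i s) l (nhds (f s))) :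
    TendstoUniformlyOn F f l K := by
  rcases l.eq_or_neBot with rfl | hne
  · intro u hu; simp
  have hflip : ∀ x ∈ S, ∀ y ∈ S, |f x - f y| ≤ L * |x - y| := fun x hx y hy =>
    le_of_tendsto (((hF x hx).sub (hF y hy)).abs) (Eventually.of_forall fun i => hlip i x hx y hy)
  rw [Metric.tendstoUniformlyOn_iff]
  intro ε hε
  have hδ : 0 < ε / (3 * (L + 1)) := by positivity
  set δ := ε / (3 * (L + 1)) with hδd
  obtain ⟨t, htK, htf, hcov⟩ := hKc.finite_cover_balls hδ
  have hev : ∀ᶠ i in l, ∀ x ∈ t, |F i x - f x| < ε / 3 := by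
    rw [Filter.eventually_all_finite htf]
    intro x hx
    have := Metric.tendsto_nhds.1 (hF x (hKS (htK hx))) (ε / 3) (by positivity)
    simpa [Real.dist_eq] using this
  filter_upwards [hev] with i hi x hx
  obtain ⟨y, hy, hxy⟩ : ∃ y ∈ t, |x - y| < δ := by
    have := hcov hx
    simp only [mem_iUnion, Metric.mem_ball, Real.dist_eq, exists_prop] at this
    exact this
  have hLδ : L * |x - y| ≤ ε / 3 := by
    calc L * |x - y| ≤ (L + 1) * δ := by gcongr; linarith
      _ = ε / 3 := by rw [hδd]; field_simp
  have h1 := hlip i x (hKS hx) y (hKS (htK hy))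
  have h2 := hflip x (hKS hx) y (hKS (htK hy))
  have h3 := hi y hy
  rw [Real.dist_eq]
  rw [abs_le] at h1 h2
  rw [abs_lt] at h3 ⊢
  constructor <;> linarith

lemma semi_pre {d r h k c : ℝ} (hd : 0 < d) (hh : h ∈ Ioo (0:ℝ) 1) (hk : k ∈ Ioo (0:ℝ) 1)
    {φ ψ : ℝ → ℝ} (H : IsSemiWave d r h k c φ ψ) :
    PreWave d r h k c φ (derivWithin φ (Ici 0)) ψ (deriv ψ) := by
  obtain ⟨hu0, hu1, hv0, hv1, -, -⟩ := star_facts hh hk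
  have hUD : UniqueDiffOn ℝ (Ici (0:ℝ)) := uniqueDiffOn_Ici 0
  have hphi1 : DifferentiableOn ℝ φ (Ici 0) := H.smooth_phi.differentiableOn (by norm_num)
  have hq1 : ContDiffOn ℝ 1 (derivWithin φ (Ici 0)) (Ici 0) :=
    H.smooth_phi.derivWithin hUD (by norm_num)
  have hq2 : ContinuousOn (derivWithin (derivWithin φ (Ici 0)) (Ici 0)) (Ici 0) :=
    (hq1.derivWithin (m := 0) hUD (by norm_num)).continuousOn
  have hpsic : Continuous ψ := H.smooth_psi.continuous
  have hpsi1 : Differentiable ℝ ψ := H.smooth_psi.differentiable (by norm_num)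
  have hp1 : ContDiff ℝ 1 (deriv ψ) := by
    have := H.smooth_psi
    rw [show (2 : WithTop ℕ∞) = 1 + 1 by norm_num, contDiff_succ_iff_deriv] at this
    exact this.2.2
  have e1 : ∀ s > (0:ℝ), derivWithin φ (Ici 0) s = deriv φ s := fun s hs =>
    derivWithin_of_mem_nhds (Ici_mem_nhds hs)
  have e2 : ∀ s > (0:ℝ), derivWithin (derivWithin φ (Ici 0)) (Ici 0) s = deriv (deriv φ) s := by
    intro s hs
    rw [derivWithin_of_mem_nhds (Ici_mem_nhds hs)]
    apply Filter.EventuallyEq.deriv_eq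
    filter_upwards [Ioi_mem_nhds hs] with t ht using e1 t ht
  have ode0 : EqOn (derivWithin (derivWithin φ (Ici 0)) (Ici 0))
      (fun s => c * derivWithin φ (Ici 0) s - φ s * (1 - φ s - k * ψ s)) (Ici 0) := by
    have hsub : Ici (0:ℝ) ⊆ closure (Ioi 0) := by rw [closure_Ioi]
    refine EqOn.of_subset_closure (s := Ioi 0) ?_ hq2 ?_ Ioi_subset_Ici_self hsub
    · intro s hs
      have := H.ode_phi s hs
      simp only [e1 s hs, e2 s hs]; linarith
    · have := hq1.continuousOn
      have h2 := H.cont_phi.continuousOn (s := Ici (0:ℝ))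
      have h3 := hpsic.continuousOn (s := Ici (0:ℝ))
      fun_prop
  have hmono : MonotoneOn φ (Ici 0) := by
    apply monotoneOn_of_deriv_nonneg (convex_Ici 0) H.cont_phi.continuousOn
    · rw [interior_Ici]; exact hphi1.mono Ioi_subset_Ici_self
    · rw [interior_Ici]; intro s hs; exact (H.phi_deriv_pos s hs).le
  have hanti : Antitone ψ := antitone_of_deriv_nonpos hpsi1 (fun s => (H.psi_deriv_neg s).le)
  have phi0 : ∀ s, 0 ≤ φ s := by
    intro s
    rcases le_total s 0 with hs | hs
    · rw [H.phi_zero s hs]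
    · have := hmono (mem_Ici.2 le_rfl) (mem_Ici.2 hs) hs
      rwa [H.phi_zero 0 le_rfl] at this
  refine ⟨H.phi_zero, fun s hs => (hphi1 s hs).hasDerivWithinAt, ?_,
    fun s => (hpsi1 s).hasDerivAt, ?_, ?_, fun s => (H.psi_deriv_neg s).le, phi0, ?_, ?_, ?_⟩
  · intro s hs
    have := ((hq1.differentiableOn (by norm_num)) s hs).hasDerivWithinAt
    rwa [ode0 hs] at this
  · intro s
    have := ((hp1.differentiable (by norm_num)) s).hasDerivAt
    refine this.congr_deriv ?_
    have := H.ode_psi s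
    rw [eq_div_iff hd.ne']
    linarith
  · intro s hs
    exact hmono.derivWithin_nonneg
  · intro s
    rcases le_total s 0 with hs | hs
    · rw [H.phi_zero s hs]; norm_num
    · refine le_trans ?_ hu1.le
      refine ge_of_tendsto H.phi_atTop ?_
      filter_upwards [eventually_ge_atTop s] with t ht
      exact hmono hs (le_trans hs ht) ht
  · intro s
    refine le_of_tendsto H.psi_atTop ?_
    filter_upwards [eventually_ge_atTop s] with t ht using hanti ht
  · intro s
    refine ge_of_tendsto H.psi_atBot ?_
    filter_upwards [eventually_le_atBot s] with t ht using hanti ht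

lemma lip_mul {S : Set ℝ} {f g : ℝ → ℝ} {A B : ℝ}
    (hf : ∀ x ∈ S, ∀ y ∈ S, |f x - f y| ≤ A * |x - y|)
    (hg : ∀ x ∈ S, ∀ y ∈ S, |g x - g y| ≤ B * |x - y|)
    (hf1 : ∀ x ∈ S, |f x| ≤ 1) (hg1 : ∀ x ∈ S, |g x| ≤ 1) :
    ∀ x ∈ S, ∀ y ∈ S, |f x * g x - f y * g y| ≤ (A + B) * |x - y| := by
  intro x hx y hy
  have e : f x * g x - f y * g y = (f x - f y) * g x + f y * (g x - g y) := by ring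
  rw [e]
  refine (abs_add_le _ _).trans ?_
  rw [abs_mul, abs_mul]
  have h1 := hf x hx y hy
  have h2 := hg x hx y hy
  have h3 : |f x - f y| * |g x| ≤ |f x - f y| * 1 := by gcongr; exact hg1 x hx
  have h4 : |f y| * |g x - g y| ≤ 1 * |g x - g y| := by gcongr; exact hf1 y hy
  linarith

lemma pre_bounds {d r h k C : ℝ} (hd : 0 < d) (hr : 0 < r) (hC : 0 ≤ C)
    (hh : h ∈ Ioo (0:ℝ) 1) (hk : k ∈ Ioo (0:ℝ) 1) :
    ∃ L : ℝ, 0 ≤ L ∧ ∀ c φ q ψ p, 0 ≤ c → c ≤ C → PreWave d r h k c φ q ψ p →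
      (∀ s ∈ Ici (0:ℝ), |q s| ≤ L) ∧ (∀ s, |p s| ≤ L) ∧
      (∀ x ∈ Ici (0:ℝ), ∀ y ∈ Ici (0:ℝ), |φ x - φ y| ≤ L * |x - y|) ∧
      (∀ x ∈ Ici (0:ℝ), ∀ y ∈ Ici (0:ℝ), |q x - q y| ≤ L * |x - y|) ∧
      (∀ x ∈ Ici (0:ℝ), ∀ y ∈ Ici (0:ℝ), |(c * q x - φ x * (1 - φ x - k * ψ x)) -
        (c * q y - φ y * (1 - φ y - k * ψ y))| ≤ L * |x - y|) ∧
      (∀ x ∈ (univ : Set ℝ), ∀ y ∈ (univ : Set ℝ), |ψ x - ψ y| ≤ L * |x - y|) ∧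
      (∀ x ∈ (univ : Set ℝ), ∀ y ∈ (univ : Set ℝ), |p x - p y| ≤ L * |x - y|) ∧
      (∀ x ∈ (univ : Set ℝ), ∀ y ∈ (univ : Set ℝ),
        |((c * p x - r * ψ x * (1 - ψ x - h * φ x)) / d) -
          ((c * p y - r * ψ y * (1 - ψ y - h * φ y)) / d)| ≤ L * |x - y|) := by
  obtain ⟨hu0, hu1, hv0, hv1, -, -⟩ := star_facts hh hk
  obtain ⟨h0, h1⟩ := hh
  obtain ⟨k0, k1⟩ := hk
  set A := 1 + r / d with hA
  have hApos : 0 < A := by positivity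
  set Q := C * 2 + 1 with hQ
  set P := (C * A + r) / d with hP
  have hQpos : 0 ≤ Q := by positivity
  have hPpos : 0 ≤ P := by positivity
  set Q2 := C * Q + (2 + (2 + A)) with hQ2
  set P2 := (C * P + r * (A + (A + 2))) / d with hP2
  have hQ2pos : 0 ≤ Q2 := by positivity
  have hP2pos : 0 ≤ P2 := by positivity
  refine ⟨2 + A + Q + P + Q2 + P2, by positivity, ?_⟩
  intro c φ q ψ p hc0 hcC H
  have psipos : ∀ s, 0 < ψ s := fun s => hv0.trans_le (H.psi0 s)
  -- bound on the nonlinearities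
  have hf1 : ∀ s, |1 - φ s - k * ψ s| ≤ 1 := by
    intro s
    have := H.phi0 s; have := H.phi1 s; have := H.psi1 s; have := psipos s
    rw [abs_le]; constructor
    · nlinarith
    · nlinarith [mul_pos k0 (psipos s)]
  have hg1 : ∀ s, |1 - ψ s - h * φ s| ≤ 1 := by
    intro s
    have := H.phi0 s; have := H.phi1 s; have := H.psi1 s; have := psipos s
    rw [abs_le]; constructor
    · nlinarith
    · nlinarith [mul_nonneg h0.le (H.phi0 s)]
  have hphia : ∀ s, |φ s| ≤ 1 := fun s => abs_le.2 ⟨by linarith [H.phi0 s], H.phi1 s⟩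
  have hpsia : ∀ s, |ψ s| ≤ 1 := fun s => abs_le.2 ⟨by linarith [psipos s], H.psi1 s⟩
  have hf2 : ∀ s, |φ s * (1 - φ s - k * ψ s)| ≤ 1 := by
    intro s; rw [abs_mul]
    exact mul_le_one₀ (hphia s) (abs_nonneg _) (hf1 s)
  have hg2 : ∀ s, |ψ s * (1 - ψ s - h * φ s)| ≤ 1 := by
    intro s; rw [abs_mul]
    exact mul_le_one₀ (hpsia s) (abs_nonneg _) (hg1 s)
  -- q ≤ 2
  have hqc : ContinuousOn q (Ici 0) := fun s hs => (H.dq s hs).continuousWithinAt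
  have hphic : ContinuousOn φ (Ici 0) := fun s hs => (H.dphi s hs).continuousWithinAt
  have hdq : ∀ s > (0:ℝ), HasDerivAt q (c * q s - φ s * (1 - φ s - k * ψ s)) s := fun s hs =>
    (H.dq s hs.le).hasDerivAt (Ici_mem_nhds hs)
  have hdphi : ∀ s > (0:ℝ), HasDerivAt φ (q s) s := fun s hs =>
    (H.dphi s hs.le).hasDerivAt (Ici_mem_nhds hs)
  have hqm : MonotoneOn (fun s => q s + s) (Ici 0) := by
    apply monotoneOn_of_hasDerivWithinAt_nonneg (convex_Ici 0) (by fun_prop)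
      (f' := fun s => c * q s - φ s * (1 - φ s - k * ψ s) + 1)
    · intro s hs
      rw [interior_Ici] at hs ⊢
      exact ((hdq s hs).add (hasDerivAt_id s)).hasDerivWithinAt
    · intro s hs
      rw [interior_Ici] at hs
      have := (abs_le.1 (hf2 s)).2
      have := mul_nonneg hc0 (H.q0 s (mem_Ici.2 (le_of_lt (mem_Ioi.1 hs))))
      linarith
  have hq2 : ∀ s ∈ Ici (0:ℝ), |q s| ≤ 2 := by
    intro s hs
    rw [abs_of_nonneg (H.q0 s hs)]
    obtain ⟨t, ht, hte⟩ := exists_hasDerivAt_eq_slope φ q (show s < s + 1 by linarith)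
      (hphic.mono (fun x hx => le_trans hs hx.1)) (fun x hx => hdphi x (lt_of_le_of_lt hs hx.1))
    have h2 := hqm hs (show t ∈ Ici (0:ℝ) from (lt_of_le_of_lt hs ht.1).le) ht.1.le
    simp only at h2
    rw [show s + 1 - s = 1 by ring, div_one] at hte
    linarith [H.phi0 s, H.phi1 (s + 1), ht.2]
  have hpm : Antitone (fun s => p s - r / d * s) := by
    apply antitone_of_hasDerivAt_nonpos
      (f' := fun s => (c * p s - r * ψ s * (1 - ψ s - h * φ s)) / d - r / d * 1)
    · intro s
      exact (H.dp s).sub ((hasDerivAt_id s).const_mul (r / d))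
    · intro s
      have h1 := (abs_le.1 (hg2 s)).1
      have h2 := mul_nonneg hc0 (neg_nonneg.2 (H.p0 s))
      change (c * p s - r * ψ s * (1 - ψ s - h * φ s)) / d - r / d * 1 ≤ 0
      rw [show (c * p s - r * ψ s * (1 - ψ s - h * φ s)) / d - r / d * 1
        = (c * p s - r * (ψ s * (1 - ψ s - h * φ s) + 1)) / d by ring]
      apply div_nonpos_of_nonpos_of_nonneg _ hd.le
      have := mul_nonneg hr.le (show 0 ≤ ψ s * (1 - ψ s - h * φ s) + 1 by linarith)
      linarith
  have hpA : ∀ s, |p s| ≤ A := by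
    intro s
    rw [abs_of_nonpos (H.p0 s)]
    obtain ⟨t, ht, hte⟩ := exists_hasDerivAt_eq_slope ψ p (show s < s + 1 by linarith)
      (fun x _ => (H.dpsi x).continuousAt.continuousWithinAt) (fun x _ => H.dpsi x)
    have h2 := hpm ht.1.le
    simp only at h2
    rw [show s + 1 - s = 1 by ring, div_one] at hte
    have h3 : r / d * t ≤ r / d * (s + 1) := by gcongr; exact ht.2.le
    linarith [psipos (s + 1), H.psi1 s]
  have hphil := lip_of_deriv (convex_Ici 0) H.dphi hq2
  have hql := lip_of_deriv (convex_Ici 0) (L := Q) H.dq (by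
    intro s hs
    refine (abs_sub _ _).trans ?_
    rw [abs_mul, abs_of_nonneg hc0]
    have := hq2 s hs
    have := hf2 s
    have : c * |q s| ≤ C * 2 := by gcongr
    linarith)
  have hpsil := lip_of_deriv convex_univ (fun s _ => (H.dpsi s).hasDerivWithinAt (s := univ))
    (fun s _ => hpA s)
  have hpl := lip_of_deriv convex_univ (L := P) (fun s _ => (H.dp s).hasDerivWithinAt (s := univ)) (by
    intro s _
    rw [abs_div, abs_of_pos hd]
    apply div_le_div_of_nonneg_right _ hd.le
    refine (abs_sub _ _).trans ?_
    rw [abs_mul, abs_of_nonneg hc0, mul_assoc r, abs_mul r, abs_of_pos hr]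
    have h1 : c * |p s| ≤ C * A := by gcongr; exact hpA s
    have h2 : r * |ψ s * (1 - ψ s - h * φ s)| ≤ r * 1 := by gcongr; exact hg2 s
    linarith)
  have hphilR : ∀ x ∈ (univ : Set ℝ), ∀ y ∈ (univ : Set ℝ), |φ x - φ y| ≤ 2 * |x - y| := by
    have key : ∀ x y : ℝ, x ≤ y → |φ x - φ y| ≤ 2 * |x - y| := by
      intro x y hxy
      rcases le_total 0 x with hx | hx
      · exact hphil x hx y (le_trans hx hxy)
      · rcases le_total 0 y with hy | hy
        · have := hphil 0 (mem_Ici.2 le_rfl) y hy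
          rw [H.z x hx, ← H.z 0 le_rfl]
          refine this.trans ?_
          rw [abs_of_nonpos (by linarith), abs_of_nonpos (by linarith)]
          linarith
        · rw [H.z x hx, H.z y hy]; simp
    intro x _ y _
    rcases le_total x y with hxy | hxy
    · exact key x y hxy
    · rw [abs_sub_comm, abs_sub_comm x]; exact key y x hxy
  have hfl : ∀ x ∈ (univ : Set ℝ), ∀ y ∈ (univ : Set ℝ),
      |(1 - φ x - k * ψ x) - (1 - φ y - k * ψ y)| ≤ (2 + A) * |x - y| := by
    intro x hx y hy
    have a1 := hphilR x hx y hy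
    have a2 := hpsil x hx y hy
    have e : (1 - φ x - k * ψ x) - (1 - φ y - k * ψ y) = -((φ x - φ y) + k * (ψ x - ψ y)) := by ring
    rw [e, abs_neg]
    refine (abs_add_le _ _).trans ?_
    rw [abs_mul, abs_of_pos k0]
    have : k * |ψ x - ψ y| ≤ 1 * |ψ x - ψ y| := by gcongr
    linarith
  have hgl : ∀ x ∈ (univ : Set ℝ), ∀ y ∈ (univ : Set ℝ),
      |(1 - ψ x - h * φ x) - (1 - ψ y - h * φ y)| ≤ (A + 2) * |x - y| := by
    intro x hx y hy
    have a1 := hphilR x hx y hy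
    have a2 := hpsil x hx y hy
    have e : (1 - ψ x - h * φ x) - (1 - ψ y - h * φ y) = -((ψ x - ψ y) + h * (φ x - φ y)) := by ring
    rw [e, abs_neg]
    refine (abs_add_le _ _).trans ?_
    rw [abs_mul, abs_of_pos h0]
    have : h * |φ x - φ y| ≤ 1 * |φ x - φ y| := by gcongr
    linarith
  have hfm := lip_mul hphilR hfl (fun x _ => hphia x) (fun x _ => hf1 x)
  have hgm := lip_mul hpsil hgl (fun x _ => hpsia x) (fun x _ => hg1 x)
  have wk : ∀ {B : ℝ} (x y : ℝ) {z : ℝ}, B ≤ 2 + A + Q + P + Q2 + P2 → z ≤ B * |x - y| →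
      z ≤ (2 + A + Q + P + Q2 + P2) * |x - y| := fun x y z hB hz =>
    hz.trans (mul_le_mul_of_nonneg_right hB (abs_nonneg _))
  refine ⟨fun s hs => (hq2 s hs).trans (by linarith), fun s => (hpA s).trans (by linarith),
    fun x hx y hy => wk x y (by linarith) (hphil x hx y hy),
    fun x hx y hy => wk x y (by linarith) (hql x hx y hy), ?_,
    fun x hx y hy => wk x y (by linarith) (hpsil x hx y hy),
    fun x hx y hy => wk x y (by linarith) (hpl x hx y hy), ?_⟩
  · intro x hx y hy
    apply wk x y (B := Q2) (by linarith)
    have b1 := hql x hx y hy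
    have b2 := hfm x trivial y trivial
    rw [show (c * q x - φ x * (1 - φ x - k * ψ x)) - (c * q y - φ y * (1 - φ y - k * ψ y)) =
      c * (q x - q y) - (φ x * (1 - φ x - k * ψ x) - φ y * (1 - φ y - k * ψ y)) by ring]
    refine (abs_sub _ _).trans ?_
    rw [abs_mul, abs_of_nonneg hc0]
    have : c * |q x - q y| ≤ C * (Q * |x - y|) := by gcongr
    rw [hQ2]; linarith
  · intro x hx y hy
    apply wk x y (B := P2) (by linarith)
    have b1 := hpl x hx y hy
    have b2 := hgm x hx y hy
    rw [show ((c * p x - r * ψ x * (1 - ψ x - h * φ x)) / d) -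
          ((c * p y - r * ψ y * (1 - ψ y - h * φ y)) / d) =
      (c * (p x - p y) - r * (ψ x * (1 - ψ x - h * φ x) - ψ y * (1 - ψ y - h * φ y))) / d by ring]
    rw [abs_div, abs_of_pos hd, hP2, div_mul_eq_mul_div]
    apply div_le_div_of_nonneg_right _ hd.le
    refine (abs_sub _ _).trans ?_
    rw [abs_mul, abs_mul, abs_of_nonneg hc0, abs_of_pos hr]
    have : c * |p x - p y| ≤ C * (P * |x - y|) := by gcongr
    have : r * |ψ x * (1 - ψ x - h * φ x) - ψ y * (1 - ψ y - h * φ y)| ≤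
      r * ((A + (A + 2)) * |x - y|) := by gcongr
    linarith

lemma pre_limit {d r h k C : ℝ} (hd : 0 < d) (hr : 0 < r) (hC : 0 ≤ C)
    (hh : h ∈ Ioo (0:ℝ) 1) (hk : k ∈ Ioo (0:ℝ) 1)
    {l : Filter ℕ} [l.NeBot] {ci : ℕ → ℝ} {c : ℝ} (hci : ∀ i, 0 ≤ ci i ∧ ci i ≤ C)
    (hc : Tendsto ci l (nhds c)) {F Q Y P : ℕ → ℝ → ℝ} {φ q ψ p : ℝ → ℝ}
    (H : ∀ i, PreWave d r h k (ci i) (F i) (Q i) (Y i) (P i))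
    (hF : ∀ s, Tendsto (fun i => F i s) l (nhds (φ s)))
    (hQ : ∀ s ∈ Ici (0:ℝ), Tendsto (fun i => Q i s) l (nhds (q s)))
    (hY : ∀ s, Tendsto (fun i => Y i s) l (nhds (ψ s)))
    (hP : ∀ s, Tendsto (fun i => P i s) l (nhds (p s))) :
    PreWave d r h k c φ q ψ p := by
  obtain ⟨L, hL, hb⟩ := pre_bounds hd hr hC hh hk
  have hb' := fun i => hb _ _ _ _ _ (hci i).1 (hci i).2 (H i)
  refine ⟨?_, ?_, ?_, ?_, ?_, ?_, ?_, ?_, ?_, ?_, ?_⟩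
  · intro s hs
    refine tendsto_nhds_unique (hF s) ?_
    simp only [(H _).z s hs]
    exact tendsto_const_nhds
  · refine hasDeriv_limit (L := L) (F := F) (G := Q) (l := l) (fun i => ?_) (fun s _ => hF s) hQ
    exact quad_of_lip (convex_Ici 0) (H i).dphi (hb' i).2.2.2.1 hL
  · refine hasDeriv_limit (L := L) (F := Q) (l := l)
      (G := fun i s => ci i * Q i s - F i s * (1 - F i s - k * Y i s))
      (g := fun s => c * q s - φ s * (1 - φ s - k * ψ s))
      (fun i => ?_) hQ ?_
    · exact quad_of_lip (convex_Ici 0) (H i).dq (hb' i).2.2.2.2.1 hL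
    · intro s hs
      exact (hc.mul (hQ s hs)).sub
        ((hF s).mul (((tendsto_const_nhds).sub (hF s)).sub ((hY s).const_mul k)))
  · intro s
    rw [← hasDerivWithinAt_univ]
    refine hasDeriv_limit (S := univ) (L := L) (F := Y) (G := P) (l := l) (fun i => ?_)
      (fun s _ => hY s) (fun s _ => hP s) s trivial
    exact quad_of_lip convex_univ (fun s _ => ((H i).dpsi s).hasDerivWithinAt)
      (hb' i).2.2.2.2.2.2.1 hL
  · intro s
    rw [← hasDerivWithinAt_univ]
    refine hasDeriv_limit (S := univ) (L := L) (F := P) (l := l)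
      (G := fun i s => (ci i * P i s - r * Y i s * (1 - Y i s - h * F i s)) / d)
      (g := fun s => (c * p s - r * ψ s * (1 - ψ s - h * φ s)) / d)
      (fun i => ?_) (fun s _ => hP s) ?_ s trivial
    · exact quad_of_lip convex_univ (fun s _ => ((H i).dp s).hasDerivWithinAt)
        (hb' i).2.2.2.2.2.2.2 hL
    · intro s _
      exact ((hc.mul (hP s)).sub (((hY s).const_mul r).mul
        (((tendsto_const_nhds).sub (hY s)).sub ((hF s).const_mul h)))).div_const d
  · intro s hs
    exact ge_of_tendsto (hQ s hs) (Eventually.of_forall fun i => (H i).q0 s hs)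
  · intro s
    exact le_of_tendsto (hP s) (Eventually.of_forall fun i => (H i).p0 s)
  · intro s
    exact ge_of_tendsto (hF s) (Eventually.of_forall fun i => (H i).phi0 s)
  · intro s
    exact le_of_tendsto (hF s) (Eventually.of_forall fun i => (H i).phi1 s)
  · intro s
    exact ge_of_tendsto (hY s) (Eventually.of_forall fun i => (H i).psi0 s)
  · intro s
    exact le_of_tendsto (hY s) (Eventually.of_forall fun i => (H i).psi1 s)

/-- Strong minimum principle for `y'' ≤ a y' + K y`, `y ≥ 0`. -/
lemma strong_zero {D : Set ℝ} (hD : Convex ℝ D) {y z z' : ℝ → ℝ} {a K : ℝ} (hK : 0 ≤ K)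
    (hy : ContinuousOn y D) (hz : ContinuousOn z D)
    (hdy : ∀ s ∈ interior D, HasDerivAt y (z s) s)
    (hdz : ∀ s ∈ interior D, HasDerivAt z (z' s) s)
    (hineq : ∀ s ∈ interior D, z' s ≤ a * z s + K * y s)
    (hpos : ∀ s ∈ D, 0 ≤ y s) {s0 : ℝ} (hs0 : s0 ∈ D) (hy0 : y s0 = 0) (hz0 : z s0 = 0) :
    ∀ s ∈ D, y s = 0 := by
  obtain ⟨l1, l2, hsum, hprod⟩ : ∃ l1 l2 : ℝ, l1 + l2 = a ∧ l1 * l2 = -K := by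
    refine ⟨(a + √(a ^ 2 + 4 * K)) / 2, (a - √(a ^ 2 + 4 * K)) / 2, by ring, ?_⟩
    have := Real.sq_sqrt (show 0 ≤ a ^ 2 + 4 * K by positivity)
    linear_combination (-1/4) * this
  have hexp : ∀ m s : ℝ, HasDerivAt (fun s => exp (-m * s)) (exp (-m * s) * -m) s := by
    intro m s
    have := ((hasDerivAt_id s).const_mul (-m)).exp
    simpa using this
  have hV : AntitoneOn (fun s => exp (-l1 * s) * (z s - l2 * y s)) D := by
    apply antitoneOn_of_hasDerivWithinAt_nonpos hD (by fun_prop)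
      (f' := fun s => exp (-l1 * s) * -l1 * (z s - l2 * y s) + exp (-l1 * s) * (z' s - l2 * z s))
    · intro s hs
      exact ((hexp l1 s).mul ((hdz s hs).sub ((hdy s hs).const_mul l2))).hasDerivWithinAt
    · intro s hs
      have h1 := hineq s hs
      have h2 : z' s - l2 * z s - l1 * (z s - l2 * y s) ≤ 0 := by
        have : z' s - l2 * z s - l1 * (z s - l2 * y s)
          = z' s - (l1 + l2) * z s + (l1 * l2) * y s := by ring
        rw [this, hsum, hprod]; linarith
      have h3 := mul_nonpos_of_nonneg_of_nonpos (exp_pos (-l1 * s)).le h2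
      linarith
  have hv1 : ∀ s ∈ D, s0 ≤ s → z s - l2 * y s ≤ 0 := by
    intro s hs hle
    have := hV hs0 hs hle
    simp only [hy0, hz0, mul_zero, sub_zero] at this
    by_contra hcon
    push Not at hcon
    linarith [mul_pos (exp_pos (-l1 * s)) hcon]
  have hv2 : ∀ s ∈ D, s ≤ s0 → 0 ≤ z s - l2 * y s := by
    intro s hs hle
    have := hV hs hs0 hle
    simp only [hy0, hz0, mul_zero, sub_zero] at this
    by_contra hcon
    push Not at hcon
    linarith [mul_neg_of_pos_of_neg (exp_pos (-l1 * s)) hcon]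
  have hdY : ∀ s ∈ interior D, HasDerivAt (fun s => exp (-l2 * s) * y s)
      (exp (-l2 * s) * (z s - l2 * y s)) s := by
    intro s hs
    refine ((hexp l2 s).mul (hdy s hs)).congr_deriv ?_
    ring
  have hfin : ∀ s ∈ D, exp (-l2 * s) * y s ≤ 0 → y s = 0 := by
    intro s hs hle
    apply le_antisymm _ (hpos s hs)
    by_contra hcon
    push Not at hcon
    linarith [mul_pos (exp_pos (-l2 * s)) hcon]
  intro s hs
  rcases le_total s0 s with hle | hle
  · have hanti : AntitoneOn (fun s => exp (-l2 * s) * y s) (D ∩ Ici s0) := by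
      apply antitoneOn_of_hasDerivWithinAt_nonpos (hD.inter (convex_Ici s0))
        ((show ContinuousOn _ D by fun_prop).mono inter_subset_left)
        (f' := fun s => exp (-l2 * s) * (z s - l2 * y s))
      · intro t ht
        exact (hdY t (interior_mono inter_subset_left ht)).hasDerivWithinAt
      · intro t ht
        have ht' := interior_subset ht
        exact mul_nonpos_of_nonneg_of_nonpos (exp_pos _).le (hv1 t ht'.1 ht'.2)
    have := hanti ⟨hs0, mem_Ici.2 le_rfl⟩ ⟨hs, hle⟩ hle
    simp only [hy0, mul_zero] at this
    exact hfin s hs this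
  · have hmono : MonotoneOn (fun s => exp (-l2 * s) * y s) (D ∩ Iic s0) := by
      apply monotoneOn_of_hasDerivWithinAt_nonneg (hD.inter (convex_Iic s0))
        ((show ContinuousOn _ D by fun_prop).mono inter_subset_left)
        (f' := fun s => exp (-l2 * s) * (z s - l2 * y s))
      · intro t ht
        exact (hdY t (interior_mono inter_subset_left ht)).hasDerivWithinAt
      · intro t ht
        have ht' := interior_subset ht
        exact mul_nonneg (exp_pos _).le (hv2 t ht'.1 ht'.2)
    have := hmono ⟨hs, hle⟩ ⟨hs0, mem_Iic.2 le_rfl⟩ hle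
    simp only [hy0, mul_zero] at this
    exact hfin s hs this

lemma lim_deriv_zero {F G : ℝ → ℝ} {B L : ℝ} (hF : ∀ s > (0:ℝ), HasDerivAt F (G s) s)
    (hB : ∀ s > (0:ℝ), |F s| ≤ B) (hG : Tendsto G atTop (nhds L)) : L = 0 := by
  have hex : ∀ x : ℝ, ∃ t, 0 < x → x < t ∧ G t = (F (2 * x) - F x) / x := by
    intro x
    by_cases hx : 0 < x
    · obtain ⟨t, ht, hte⟩ := exists_hasDerivAt_eq_slope F G (show x < 2 * x by linarith)
        (fun y hy => (hF y (lt_of_lt_of_le hx hy.1)).continuousAt.continuousWithinAt)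
        (fun y hy => hF y (hx.trans hy.1))
      exact ⟨t, fun _ => ⟨ht.1, by rw [hte]; congr 1; ring⟩⟩
    · exact ⟨0, fun h => absurd h hx⟩
  choose t ht using hex
  have htt : Tendsto t atTop atTop := by
    refine tendsto_atTop_mono' _ ?_ tendsto_id
    filter_upwards [eventually_gt_atTop 0] with x hx using (ht x hx).1.le
  have h1 := hG.comp htt
  refine tendsto_nhds_unique h1 ?_
  refine squeeze_zero_norm' (a := fun x => 2 * B / x) ?_ (tendsto_const_nhds.div_atTop tendsto_id)
  filter_upwards [eventually_gt_atTop 0] with x hx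
  rw [Function.comp_apply, (ht x hx).2, Real.norm_eq_abs, abs_div, abs_of_pos hx]
  apply div_le_div_of_nonneg_right _ hx.le
  have a1 := hB x hx
  have a2 := hB (2 * x) (by linarith)
  refine (abs_sub _ _).trans ?_
  linarith

set_option maxHeartbeats 2000000 in
lemma dichotomy {d r h k c : ℝ} (hd : 0 < d) (hr : 0 < r) (hc : 0 ≤ c)
    (hh : h ∈ Ioo (0:ℝ) 1) (hk : k ∈ Ioo (0:ℝ) 1) {φ q ψ p : ℝ → ℝ}
    (H : PreWave d r h k c φ q ψ p) :
    ((∀ s, φ s = 0) ∧ (∀ s, ψ s = 1)) ∨ IsSemiWave d r h k c φ ψ := by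
  obtain ⟨L, hL, hb⟩ := pre_bounds hd hr hc hh hk
  obtain ⟨hqL, hpL, -⟩ := hb _ _ _ _ _ hc le_rfl H
  obtain ⟨hu0, hu1, hv0, hv1, huv, hvu⟩ := star_facts hh hk
  obtain ⟨h0, h1⟩ := hh
  obtain ⟨k0, k1⟩ := hk
  have psipos : ∀ s, 0 < ψ s := fun s => hv0.trans_le (H.psi0 s)
  have hqc : ContinuousOn q (Ici 0) := fun s hs => (H.dq s hs).continuousWithinAt
  have hphic0 : ContinuousOn φ (Ici 0) := fun s hs => (H.dphi s hs).continuousWithinAt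
  have hpsic : Continuous ψ := continuous_iff_continuousAt.2 fun s => (H.dpsi s).continuousAt
  have hpc : Continuous p := continuous_iff_continuousAt.2 fun s => (H.dp s).continuousAt
  have hphic : Continuous φ := by
    rw [← continuousOn_univ, ← Iic_union_Ici (a := (0:ℝ))]
    refine ContinuousOn.union_of_isClosed ?_ hphic0 isClosed_Iic isClosed_Ici
    exact continuousOn_const.congr (fun s hs => H.z s hs)
  have hdq : ∀ s > (0:ℝ), HasDerivAt q (c * q s - φ s * (1 - φ s - k * ψ s)) s := fun s hs =>
    (H.dq s hs.le).hasDerivAt (Ici_mem_nhds hs)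
  have hdphi : ∀ s > (0:ℝ), HasDerivAt φ (q s) s := fun s hs =>
    (H.dphi s hs.le).hasDerivAt (Ici_mem_nhds hs)
  have hmono0 : MonotoneOn φ (Ici 0) := by
    apply monotoneOn_of_hasDerivWithinAt_nonneg (convex_Ici 0) hphic0 (f' := q)
    · intro s hs
      rw [interior_Ici] at hs ⊢
      exact (hdphi s hs).hasDerivWithinAt
    · intro s hs
      exact H.q0 s (interior_subset hs)
  have hmono : Monotone φ := by
    intro x y hxy
    rcases le_total x 0 with hx | hx
    · rw [H.z x hx]; exact H.phi0 y
    · exact hmono0 hx (le_trans hx hxy) hxy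
  have hanti : Antitone ψ := antitone_of_hasDerivAt_nonpos H.dpsi H.p0
  -- limits
  obtain ⟨a, ha⟩ : ∃ a, Tendsto φ atTop (nhds a) :=
    ⟨_, tendsto_atTop_ciSup hmono ⟨1, by rintro _ ⟨s, rfl⟩; exact H.phi1 s⟩⟩
  obtain ⟨b, hbt⟩ : ∃ b, Tendsto ψ atTop (nhds b) :=
    ⟨_, tendsto_atTop_ciInf hanti ⟨vStar h k, by rintro _ ⟨s, rfl⟩; exact H.psi0 s⟩⟩
  obtain ⟨b', hbb⟩ : ∃ b', Tendsto ψ atBot (nhds b') :=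
    ⟨_, tendsto_atBot_ciSup hanti ⟨1, by rintro _ ⟨s, rfl⟩; exact H.psi1 s⟩⟩
  have hbpos : 0 < b := hv0.trans_le (ge_of_tendsto hbt (Eventually.of_forall H.psi0))
  have hb'pos : 0 < b' := hv0.trans_le (ge_of_tendsto hbb (Eventually.of_forall H.psi0))
  have eq1 : -(a * (1 - a - k * b)) = 0 := by
    refine lim_deriv_zero (F := fun s => q s - c * φ s)
      (G := fun s => -(φ s * (1 - φ s - k * ψ s))) (B := L + c * 1) ?_ ?_ ?_
    · intro s hs
      refine ((hdq s hs).sub ((hdphi s hs).const_mul c)).congr_deriv ?_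
      ring
    · intro s hs
      refine (abs_sub _ _).trans ?_
      rw [abs_mul, abs_of_nonneg hc, abs_of_nonneg (H.phi0 s)]
      gcongr
      · exact hqL s hs.le
      · exact H.phi1 s
    · exact (ha.mul ((tendsto_const_nhds.sub ha).sub (hbt.const_mul k))).neg
  have hFd : ∀ s, HasDerivAt (fun s => d * p s - c * ψ s) (-(r * ψ s * (1 - ψ s - h * φ s))) s := by
    intro s
    refine (((H.dp s).const_mul d).sub ((H.dpsi s).const_mul c)).congr_deriv ?_
    field_simp
    ring
  have hFb : ∀ s, |d * p s - c * ψ s| ≤ d * L + c * 1 := by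
    intro s
    refine (abs_sub _ _).trans ?_
    rw [abs_mul, abs_mul, abs_of_nonneg hc, abs_of_pos (psipos s), abs_of_pos hd]
    gcongr
    · exact hpL s
    · exact H.psi1 s
  have eq2 : -(r * b * (1 - b - h * a)) = 0 := by
    refine lim_deriv_zero (fun s _ => hFd s) (fun s _ => hFb s) ?_
    exact ((hbt.const_mul r).mul ((tendsto_const_nhds.sub hbt).sub (ha.const_mul h))).neg
  have hphibot : Tendsto φ atBot (nhds 0) := by
    refine tendsto_const_nhds.congr' ?_
    filter_upwards [eventually_le_atBot 0] with s hs
    rw [H.z s hs]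
  have eq3 : r * b' * (1 - b' - h * 0) = 0 := by
    refine lim_deriv_zero (F := fun s => d * p (-s) - c * ψ (-s))
      (G := fun s => r * ψ (-s) * (1 - ψ (-s) - h * φ (-s))) (B := d * L + c * 1) ?_
      (fun s _ => hFb (-s)) ?_
    · intro s _
      have := (hFd (-s)).scomp s (hasDerivAt_neg s)
      refine this.congr_deriv ?_
      simp
    · exact (((hbb.const_mul r).mul ((tendsto_const_nhds.sub hbb).sub (hphibot.const_mul h)))).comp
        tendsto_neg_atTop_atBot
  have hb'1 : b' = 1 := by
    have : r * b' ≠ 0 := (mul_pos hr hb'pos).ne'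
    have := (mul_eq_zero.1 eq3).resolve_left this
    linarith
  have hb1 : b = 1 - h * a := by
    have : r * b ≠ 0 := (mul_pos hr hbpos).ne'
    have := (mul_eq_zero.1 (neg_eq_zero.1 eq2)).resolve_left this
    linarith
  rcases mul_eq_zero.1 (neg_eq_zero.1 eq1) with ha0 | ha1
  · left
    have hphi : ∀ s, φ s = 0 := by
      intro s
      apply le_antisymm _ (H.phi0 s)
      rw [← ha0]
      exact hmono.ge_of_tendsto ha s
    refine ⟨hphi, fun s => le_antisymm (H.psi1 s) ?_⟩
    have := hanti.le_of_tendsto hbt s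
    rw [hb1, ha0] at this
    linarith
  · right
    have hau : a = uStar h k := by
      have hpos : 0 < 1 - h * k := by nlinarith
      unfold uStar
      rw [eq_div_iff hpos.ne']
      rw [hb1] at ha1
      linarith
    have hbv : b = vStar h k := by rw [hb1, hau]; linarith
    -- φ > 0 on (0,∞)
    have hphipos : ∀ s > (0:ℝ), 0 < φ s := by
      intro s0 hs0
      by_contra hcon
      have hz0 : φ s0 = 0 := le_antisymm (not_lt.1 hcon) (H.phi0 s0)
      have hmin : IsLocalMin φ s0 := Eventually.of_forall fun t => by rw [hz0]; exact H.phi0 t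
      have hq0 : q s0 = 0 := hmin.hasDerivAt_eq_zero (hdphi s0 hs0)
      have hz := strong_zero (D := Ici 0) (convex_Ici 0) (y := φ) (z := q) (a := c) (K := 1)
        (z' := fun s => c * q s - φ s * (1 - φ s - k * ψ s)) zero_le_one hphic0 hqc
        (fun s hs => hdphi s (by rwa [interior_Ici] at hs))
        (fun s hs => hdq s (by rwa [interior_Ici] at hs))
        (fun s hs => by
          have e1 := H.phi0 s; have e2 := H.phi1 s; have e3 := H.psi1 s; have e4 := psipos s
          have : 0 ≤ φ s * (1 + (1 - φ s - k * ψ s)) := mul_nonneg e1 (by nlinarith)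
          linarith)
        (fun s _ => H.phi0 s) (mem_Ici.2 hs0.le) hz0 hq0
      have : a = 0 := by
        refine tendsto_nhds_unique ha (tendsto_const_nhds.congr' ?_)
        filter_upwards [eventually_ge_atTop 0] with s hs using (hz s hs).symm
      linarith
    -- ψ < 1
    have hpsilt : ∀ s, ψ s < 1 := by
      intro s0
      by_contra hcon
      have hz0 : ψ s0 = 1 := le_antisymm (H.psi1 s0) (not_lt.1 hcon)
      have hmax : IsLocalMax ψ s0 := Eventually.of_forall fun t => by rw [hz0]; exact H.psi1 t
      have hp0 : p s0 = 0 := hmax.hasDerivAt_eq_zero (H.dpsi s0)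
      have hz := strong_zero (D := univ) convex_univ (y := fun s => 1 - ψ s) (z := fun s => -p s)
        (a := c / d) (K := r / d)
        (z' := fun s => -((c * p s - r * ψ s * (1 - ψ s - h * φ s)) / d)) (by positivity)
        (by fun_prop) (by fun_prop)
        (fun s _ => (H.dpsi s).const_sub 1) (fun s _ => (H.dp s).neg)
        (fun s _ => by
          have e1 := H.phi0 s; have e3 := H.psi1 s; have e4 := psipos s
          rw [show c / d * -p s + r / d * (1 - ψ s) = (-(c * p s) + r * (1 - ψ s)) / d by ring,
            ← neg_div]
          apply div_le_div_of_nonneg_right _ hd.le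
          have : 0 ≤ r * ((1 - ψ s) * (1 - ψ s) + ψ s * (h * φ s)) := by
            have := mul_self_nonneg (1 - ψ s)
            positivity
          linarith)
        (fun s _ => by linarith [H.psi1 s]) (mem_univ s0) (by simp [hz0]) (by simp [hp0])
      have : b = 1 := by
        refine tendsto_nhds_unique hbt (tendsto_const_nhds.congr fun s => ?_)
        have := hz s trivial
        linarith
      linarith
    have hqpos : ∀ s > (0:ℝ), 0 < q s := by
      intro s0 hs0
      by_contra hcon
      have hz0 : q s0 = 0 := le_antisymm (not_lt.1 hcon) (H.q0 s0 hs0.le)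
      have hmin : IsLocalMin q s0 := by
        filter_upwards [Ici_mem_nhds hs0] with t ht
        rw [hz0]; exact H.q0 t ht
      have hq0 := hmin.hasDerivAt_eq_zero (hdq s0 hs0)
      have hz := strong_zero (D := Ici 0) (convex_Ici 0) (y := q)
        (z := fun s => c * q s - φ s * (1 - φ s - k * ψ s)) (a := c) (K := 2)
        (z' := fun s => c * (c * q s - φ s * (1 - φ s - k * ψ s)) -
          (q s * (1 - φ s - k * ψ s) + φ s * (0 - q s - k * p s))) (by norm_num) hqc
        (by have := hpsic.continuousOn (s := Ici (0:ℝ)); fun_prop)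
        (fun s hs => hdq s (by rwa [interior_Ici] at hs))
        (fun s hs => by
          have hs : 0 < s := by rwa [interior_Ici] at hs
          exact ((hdq s hs).const_mul c).sub ((hdphi s hs).mul
            (((hasDerivAt_const s (1:ℝ)).sub (hdphi s hs)).sub ((H.dpsi s).const_mul k))))
        (fun s hs => by
          have hs : 0 < s := by rwa [interior_Ici] at hs
          have e1 := H.phi0 s; have e2 := H.phi1 s; have e3 := H.psi1 s; have e4 := psipos s
          have e5 := H.q0 s hs.le
          have e6 := H.p0 s
          have a1 : 0 ≤ q s * (1 - φ s) := mul_nonneg e5 (by linarith)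
          have a2 : 0 ≤ q s * (1 - k * ψ s) := mul_nonneg e5 (by nlinarith)
          have a3 : 0 ≤ φ s * (k * -p s) := mul_nonneg e1 (mul_nonneg k0.le (by linarith))
          have a4 : q s * φ s ≤ q s * 1 := by gcongr
          nlinarith)
        (fun s hs => H.q0 s hs) (mem_Ici.2 hs0.le) hz0 hq0
      have hcst : φ 1 = φ 0 := by
        have := lip_of_deriv (convex_Ici 0) (L := 0) H.dphi
          (fun s hs => by rw [hz s hs]; simp) 1 (by simp) 0 (by simp)
        rw [zero_mul] at this
        have := abs_eq_zero.1 (le_antisymm this (abs_nonneg _))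
        linarith
      have := hphipos 1 one_pos
      rw [hcst, H.z 0 le_rfl] at this
      exact lt_irrefl _ this
    have hpneg : ∀ s, p s < 0 := by
      intro s0
      by_contra hcon
      have hz0 : p s0 = 0 := le_antisymm (H.p0 s0) (not_lt.1 hcon)
      have hmax : IsLocalMax p s0 := Eventually.of_forall fun t => by rw [hz0]; exact H.p0 t
      have hp0 := hmax.hasDerivAt_eq_zero (H.dp s0)
      have hcontz : Continuous (fun s => -((c * p s - r * ψ s * (1 - ψ s - h * φ s)) / d)) := by
        fun_prop
      rcases le_total 0 s0 with hs0 | hs0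
      · have hz := strong_zero (D := Ici 0) (convex_Ici 0) (y := fun s => -p s)
          (z := fun s => -((c * p s - r * ψ s * (1 - ψ s - h * φ s)) / d)) (a := c / d)
          (K := 2 * r / d)
          (z' := fun s => -((c * ((c * p s - r * ψ s * (1 - ψ s - h * φ s)) / d) -
            (r * p s * (1 - ψ s - h * φ s) + r * ψ s * (0 - p s - h * q s))) / d))
          (by positivity) (by fun_prop) hcontz.continuousOn
          (fun s _ => (H.dp s).neg)
          (fun s hs => by
            have hs : 0 < s := by rwa [interior_Ici] at hs
            exact ((((H.dp s).const_mul c).sub (((H.dpsi s).const_mul r).mul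
              (((hasDerivAt_const s (1:ℝ)).sub (H.dpsi s)).sub ((hdphi s hs).const_mul h)))).div_const
                d).neg)
          (fun s hs => by
            have hs : 0 < s := by rwa [interior_Ici] at hs
            have e1 := H.phi0 s; have e2 := H.phi1 s; have e3 := H.psi1 s; have e4 := psipos s
            have e5 := H.q0 s hs.le
            have e6 := H.p0 s
            set Z := (c * p s - r * ψ s * (1 - ψ s - h * φ s)) / d with hZ
            rw [show c / d * -Z + 2 * r / d * -p s = (-(c * Z) + 2 * r * -p s) / d by ring,
              ← neg_div]
            apply div_le_div_of_nonneg_right _ hd.le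
            have a1 : 0 ≤ r * (-p s) * (1 + (1 - ψ s - h * φ s) + (1 - ψ s)) :=
              mul_nonneg (mul_nonneg hr.le (by linarith)) (by nlinarith)
            have a2 : 0 ≤ r * ψ s * (h * q s) := by positivity
            nlinarith)
          (fun s _ => by linarith [H.p0 s]) (mem_Ici.2 hs0) (by simp [hz0]) (by simp [hp0])
        have hpz : ∀ s ∈ Ici (0:ℝ), p s = 0 := fun s hs => by
          have := hz s hs
          linarith
        -- then `p' = 0` for `s > 0`, so `ψ = 1 - h φ`, and both are constant
        have hpsieq : ∀ s ∈ Ici (0:ℝ), ψ s = ψ 0 := by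
          intro s hs
          have := lip_of_deriv (convex_Ici 0) (L := 0) (fun s _ => (H.dpsi s).hasDerivWithinAt)
            (fun s hs => by rw [hpz s hs]; simp) s hs 0 (by simp)
          rw [zero_mul] at this
          have := abs_eq_zero.1 (le_antisymm this (abs_nonneg _))
          linarith
        have hrel : ∀ s ∈ Ici (0:ℝ), 1 - ψ s - h * φ s = 0 := by
          intro s hs
          have hmax : IsLocalMax p s := Eventually.of_forall fun t => by
            rw [hpz s hs]; exact H.p0 t
          have h2 := hmax.hasDerivAt_eq_zero (H.dp s)
          rw [hpz s hs, mul_zero, zero_sub, div_eq_zero_iff] at h2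
          have h3 := neg_eq_zero.1 (h2.resolve_right hd.ne')
          exact (mul_eq_zero.1 h3).resolve_left (mul_pos hr (psipos s)).ne'
        have r0 := hrel 0 (by simp)
        rw [H.z 0 le_rfl] at r0
        linarith [hpsilt 0]
      · have hz := strong_zero (D := Iic 0) (convex_Iic 0) (y := fun s => -p s)
          (z := fun s => -((c * p s - r * ψ s * (1 - ψ s - h * φ s)) / d)) (a := c / d)
          (K := 2 * r / d)
          (z' := fun s => -((c * ((c * p s - r * ψ s * (1 - ψ s - h * φ s)) / d) -
            (r * p s * (1 - ψ s - h * φ s) + r * ψ s * (0 - p s - h * 0))) / d))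
          (by positivity) (by fun_prop) hcontz.continuousOn
          (fun s _ => (H.dp s).neg)
          (fun s hs => by
            have hs : s < 0 := by rwa [interior_Iic] at hs
            have hdphi0 : HasDerivAt φ 0 s := by
              refine (hasDerivAt_const s (0:ℝ)).congr_of_eventuallyEq ?_
              filter_upwards [Iic_mem_nhds hs] with t ht using H.z t ht
            exact ((((H.dp s).const_mul c).sub (((H.dpsi s).const_mul r).mul
              (((hasDerivAt_const s (1:ℝ)).sub (H.dpsi s)).sub (hdphi0.const_mul h)))).div_const
                d).neg)
          (fun s hs => by
            have e1 := H.phi0 s; have e2 := H.phi1 s; have e3 := H.psi1 s; have e4 := psipos s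
            have e6 := H.p0 s
            set Z := (c * p s - r * ψ s * (1 - ψ s - h * φ s)) / d with hZ
            rw [show c / d * -Z + 2 * r / d * -p s = (-(c * Z) + 2 * r * -p s) / d by ring,
              ← neg_div]
            apply div_le_div_of_nonneg_right _ hd.le
            have a1 : 0 ≤ r * (-p s) * (1 + (1 - ψ s - h * φ s) + (1 - ψ s)) :=
              mul_nonneg (mul_nonneg hr.le (by linarith)) (by nlinarith)
            nlinarith)
          (fun s _ => by linarith [H.p0 s]) (mem_Iic.2 hs0) (by simp [hz0]) (by simp [hp0])
        have hpz : ∀ s ∈ Iic (0:ℝ), p s = 0 := fun s hs => by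
          have := hz s hs
          linarith
        have hpsieq : ∀ s ∈ Iic (0:ℝ), ψ s = ψ 0 := by
          intro s hs
          have := lip_of_deriv (convex_Iic 0) (L := 0) (fun s _ => (H.dpsi s).hasDerivWithinAt)
            (fun s hs => by rw [hpz s hs]; simp) s hs 0 (by simp)
          rw [zero_mul] at this
          have := abs_eq_zero.1 (le_antisymm this (abs_nonneg _))
          linarith
        have : b' = ψ 0 := by
          refine tendsto_nhds_unique hbb (tendsto_const_nhds.congr' ?_)
          filter_upwards [eventually_le_atBot 0] with s hs using (hpsieq s hs).symm
        linarith [hpsilt 0]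
    have hderivphi : ∀ s > (0:ℝ), deriv φ s = q s := fun s hs => (hdphi s hs).deriv
    have hderivpsi : deriv ψ = p := funext fun s => (H.dpsi s).deriv
    have hderivp : deriv p = fun s => (c * p s - r * ψ s * (1 - ψ s - h * φ s)) / d :=
      funext fun s => (H.dp s).deriv
    have hUD : UniqueDiffOn ℝ (Ici (0:ℝ)) := uniqueDiffOn_Ici 0
    refine ⟨hphic, ?_, H.z, ?_, ?_, ?_, ?_, ?_, ?_, ?_, ?_⟩
    · rw [show (2 : WithTop ℕ∞) = 1 + 1 by norm_num, contDiffOn_succ_iff_derivWithin hUD]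
      refine ⟨fun s hs => (H.dphi s hs).differentiableWithinAt, by simp, ?_⟩
      have hq : ContDiffOn ℝ 1 q (Ici 0) := by
        rw [show (1 : WithTop ℕ∞) = 0 + 1 by norm_num, contDiffOn_succ_iff_derivWithin hUD]
        refine ⟨fun s hs => (H.dq s hs).differentiableWithinAt, by simp, ?_⟩
        rw [contDiffOn_zero]
        have : ContinuousOn (fun s => c * q s - φ s * (1 - φ s - k * ψ s)) (Ici 0) := by
          have := hpsic.continuousOn (s := Ici (0:ℝ)); fun_prop
        exact this.congr fun s hs => (H.dq s hs).derivWithin (hUD s hs)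
      exact hq.congr fun s hs => (H.dphi s hs).derivWithin (hUD s hs)
    · rw [show (2 : WithTop ℕ∞) = 1 + 1 by norm_num, contDiff_succ_iff_deriv]
      refine ⟨fun s => (H.dpsi s).differentiableAt, by simp, ?_⟩
      rw [hderivpsi, contDiff_one_iff_deriv]
      refine ⟨fun s => (H.dp s).differentiableAt, ?_⟩
      rw [hderivp]
      fun_prop
    · intro s hs
      have e : deriv (deriv φ) s = c * q s - φ s * (1 - φ s - k * ψ s) := by
        rw [← (hdq s hs).deriv]
        apply Filter.EventuallyEq.deriv_eq
        filter_upwards [Ioi_mem_nhds hs] with t ht using hderivphi t ht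
      rw [e, hderivphi s hs]; ring
    · intro s hs
      rw [hderivphi s hs]; exact hqpos s hs
    · intro s
      rw [hderivpsi, hderivp]
      field_simp
      ring
    · intro s
      rw [hderivpsi]; exact hpneg s
    · rw [← hb'1]; exact hbb
    · rw [← hau]; exact ha
    · rw [← hbv]; exact hbt

lemma second_deriv_min {z z1 : ℝ → ℝ} {s0 z2 : ℝ} (h1 : ∀ᶠ s in nhds s0, HasDerivAt z (z1 s) s)
    (h2 : HasDerivAt z1 z2 s0) (hmin : IsLocalMin z s0) : 0 ≤ z2 := by
  by_contra hcon
  push Not at hcon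
  have hd0 : z1 s0 = 0 := hmin.hasDerivAt_eq_zero h1.self_of_nhds
  have he : deriv z =ᶠ[nhds s0] z1 := h1.mono fun s hs => hs.deriv
  have hdd : deriv (deriv z) s0 = z2 := by rw [he.deriv_eq, h2.deriv]
  have hmax : IsLocalMax z s0 := isLocalMax_of_deriv_deriv_neg (by rw [hdd]; exact hcon)
    (by rw [h1.self_of_nhds.deriv, hd0]) h1.self_of_nhds.continuousAt
  have hconst : z =ᶠ[nhds s0] fun _ => z s0 := by
    filter_upwards [hmin, hmax] with s a b using le_antisymm b a
  have hz1 : z1 =ᶠ[nhds s0] fun _ => 0 := by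
    have := hconst.deriv
    simp only [deriv_const'] at this
    exact he.symm.trans this
  have := hz1.deriv_eq
  rw [h2.deriv, deriv_const] at this
  linarith

lemma end_min {f : ℝ → ℝ} (hf : Continuous f) {a b s1 : ℝ} (has : a ≤ s1) (hsb : s1 ≤ b)
    (ha : f s1 < f a) (hb : f s1 < f b) :
    ∃ s0, a < s0 ∧ s0 < b ∧ f s0 ≤ f s1 ∧ ∀ᶠ t in nhds s0, f s0 ≤ f t := by
  obtain ⟨s0, hs0, hmin⟩ := isCompact_Icc.exists_isMinOn (s := Icc a b) ⟨s1, has, hsb⟩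
    hf.continuousOn
  have hle : f s0 ≤ f s1 := hmin ⟨has, hsb⟩
  have h1 : a < s0 := lt_of_le_of_ne hs0.1 (by rintro rfl; linarith)
  have h2 : s0 < b := lt_of_le_of_ne hs0.2 (by rintro rfl; linarith)
  refine ⟨s0, h1, h2, hle, ?_⟩
  filter_upwards [Icc_mem_nhds h1 h2] with t ht using hmin ht

lemma contact_phi {d r h k c1 c2 : ℝ} (hcc : c1 < c2) {φ1 q1 ψ1 p1 φ2 q2 ψ2 p2 : ℝ → ℝ}
    (H1 : PreWave d r h k c1 φ1 q1 ψ1 p1) (H2 : PreWave d r h k c2 φ2 q2 ψ2 p2)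
    (hq2 : ∀ s > (0:ℝ), 0 < q2 s) {τ s0 : ℝ} (hτ : 0 ≤ τ) (hs0 : 0 < s0)
    (hmin : IsLocalMin (fun s => φ1 (s + τ) - φ2 s) s0) :
    φ1 (s0 + τ) * (1 - φ1 (s0 + τ) - k * ψ1 (s0 + τ)) < φ2 s0 * (1 - φ2 s0 - k * ψ2 s0) := by
  have hd1 : ∀ s > (0:ℝ), HasDerivAt (fun s => φ1 (s + τ) - φ2 s) (q1 (s + τ) - q2 s) s := by
    intro s hs
    have a1 := (H1.dphi (s + τ) (mem_Ici.2 (by linarith))).hasDerivAt (Ici_mem_nhds (by linarith))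
    have a2 := (H2.dphi s (mem_Ici.2 hs.le)).hasDerivAt (Ici_mem_nhds hs)
    exact (a1.comp_add_const s τ).sub a2
  have hd2 : HasDerivAt (fun s => q1 (s + τ) - q2 s)
      ((c1 * q1 (s0 + τ) - φ1 (s0 + τ) * (1 - φ1 (s0 + τ) - k * ψ1 (s0 + τ))) -
        (c2 * q2 s0 - φ2 s0 * (1 - φ2 s0 - k * ψ2 s0))) s0 := by
    have a1 := (H1.dq (s0 + τ) (mem_Ici.2 (by linarith))).hasDerivAt (Ici_mem_nhds (by linarith))
    have a2 := (H2.dq s0 (mem_Ici.2 hs0.le)).hasDerivAt (Ici_mem_nhds hs0)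
    exact (a1.comp_add_const s0 τ).sub a2
  have e1 := hmin.hasDerivAt_eq_zero (hd1 s0 hs0)
  have e2 := second_deriv_min (by
    filter_upwards [Ioi_mem_nhds hs0] with s hs using hd1 s hs) hd2 hmin
  have e3 : q1 (s0 + τ) = q2 s0 := by linarith
  rw [e3] at e2
  have := mul_pos (sub_pos.2 hcc) (hq2 s0 hs0)
  linarith

lemma contact_psi {d r h k c1 c2 : ℝ} (hd : 0 < d) (hr : 0 < r) (hcc : c1 < c2)
    {φ1 q1 ψ1 p1 φ2 q2 ψ2 p2 : ℝ → ℝ}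
    (H1 : PreWave d r h k c1 φ1 q1 ψ1 p1) (H2 : PreWave d r h k c2 φ2 q2 ψ2 p2)
    (hp2 : ∀ s, p2 s < 0) {τ s0 : ℝ}
    (hmin : IsLocalMin (fun s => ψ2 s - ψ1 (s + τ)) s0) :
    ψ2 s0 * (1 - ψ2 s0 - h * φ2 s0) < ψ1 (s0 + τ) * (1 - ψ1 (s0 + τ) - h * φ1 (s0 + τ)) := by
  have hd1 : ∀ s, HasDerivAt (fun s => ψ2 s - ψ1 (s + τ)) (p2 s - p1 (s + τ)) s := by
    intro s
    exact (H2.dpsi s).sub ((H1.dpsi (s + τ)).comp_add_const s τ)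
  have hd2 := (H2.dp s0).fun_sub ((H1.dp (s0 + τ)).comp_add_const s0 τ)
  have e1 := hmin.hasDerivAt_eq_zero (hd1 s0)
  have e2 := second_deriv_min (Eventually.of_forall hd1) hd2 hmin
  have e3 : p1 (s0 + τ) = p2 s0 := by linarith
  rw [e3, ← sub_div] at e2
  have e4 := (div_nonneg_iff.1 e2).resolve_right (fun hh => absurd hh.2 (not_le.2 hd))
  have := mul_pos (sub_pos.2 hcc) (neg_pos.2 (hp2 s0))
  have e5 : r * (ψ2 s0 * (1 - ψ2 s0 - h * φ2 s0)) <
    r * (ψ1 (s0 + τ) * (1 - ψ1 (s0 + τ) - h * φ1 (s0 + τ))) := by linarith [e4.1]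
  exact lt_of_mul_lt_mul_left e5 hr.le

set_option maxHeartbeats 1000000 in
lemma semi_mono {d r h k c1 c2 : ℝ} (hd : 0 < d) (hr : 0 < r) (hcc : c1 < c2)
    (hh : h ∈ Ioo (0:ℝ) 1) (hk : k ∈ Ioo (0:ℝ) 1) {φ1 ψ1 φ2 ψ2 : ℝ → ℝ}
    (S1 : IsSemiWave d r h k c1 φ1 ψ1) (S2 : IsSemiWave d r h k c2 φ2 ψ2) :
    ∀ s, φ2 s ≤ φ1 s := by
  have H1 := semi_pre hd hh hk S1
  have H2 := semi_pre hd hh hk S2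
  obtain ⟨hu0, hu1, hv0, hv1, huv, hvu⟩ := star_facts hh hk
  obtain ⟨h0, h1⟩ := hh
  obtain ⟨k0, k1⟩ := hk
  have hq2 : ∀ s > (0:ℝ), 0 < derivWithin φ2 (Ici 0) s := by
    intro s hs
    rw [derivWithin_of_mem_nhds (Ici_mem_nhds hs)]
    exact S2.phi_deriv_pos s hs
  have hp2 := S2.psi_deriv_neg
  have kphi := fun τ s0 => contact_phi (τ := τ) (s0 := s0) hcc H1 H2 hq2
  have kpsi := fun τ s0 => contact_psi (τ := τ) (s0 := s0) hd hr hcc H1 H2 hp2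
  have smono : ∀ φ ψ c, IsSemiWave d r h k c φ ψ → StrictMonoOn φ (Ici 0) := by
    intro φ ψ c S
    apply strictMonoOn_of_deriv_pos (convex_Ici 0) S.cont_phi.continuousOn
    intro s hs
    rw [interior_Ici] at hs
    exact S.phi_deriv_pos s hs
  have sm1 := smono _ _ _ S1
  have sm2 := smono _ _ _ S2
  have mono2 : Monotone φ2 := by
    intro x y hxy
    rcases le_total x 0 with hx | hx
    · rw [H2.z x hx]; exact H2.phi0 y
    · exact sm2.monotoneOn hx (le_trans hx hxy) hxy
  have sa2 : StrictAnti ψ2 := strictAnti_of_deriv_neg hp2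
  have pos1 : ∀ s > (0:ℝ), 0 < φ1 s := by
    intro s hs
    have := sm1 (mem_Ici.2 le_rfl) (mem_Ici.2 hs.le) hs
    rwa [H1.z 0 le_rfl] at this
  have c1c := S1.cont_phi
  have c2c := S2.cont_phi
  have d1c := S1.smooth_psi.continuous
  have d2c := S2.smooth_psi.continuous
  have psi1pos : ∀ s, 0 < ψ1 s := fun s => hv0.trans_le (H1.psi0 s)
  have psi2pos : ∀ s, 0 < ψ2 s := fun s => hv0.trans_le (H2.psi0 s)
  -- constants
  obtain ⟨N, hN0, hN⟩ : ∃ N : ℝ, 0 ≤ N ∧ ∀ s ≤ -N, 1 / 2 < ψ2 s := by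
    have := (S2.psi_atBot.eventually (lt_mem_nhds (show (1/2 : ℝ) < 1 by norm_num)))
    obtain ⟨N, hN⟩ := eventually_atBot.1 this
    refine ⟨max 0 (-N), le_max_left _ _, fun s hs => hN s ?_⟩
    have := le_max_right 0 (-N)
    linarith
  obtain ⟨M, hM0, hM1, hM2, hM3⟩ : ∃ M : ℝ, 0 ≤ M ∧ (∀ t ≥ M, uStar h k / 2 < φ1 t) ∧
      (∀ s ≥ M, 1 - (1 - k) * (uStar h k / 2) < φ2 s + k * ψ2 s) ∧
      (∀ s ≥ M, 1 - (1 - h) * vStar h k < ψ2 s + h * φ2 s) := by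
    have t1 := S1.phi_atTop.eventually (lt_mem_nhds (show uStar h k / 2 < uStar h k by linarith))
    have t2 := (S2.phi_atTop.add (S2.psi_atTop.const_mul k)).eventually (lt_mem_nhds
      (show 1 - (1 - k) * (uStar h k / 2) < uStar h k + k * vStar h k by
        have := mul_pos (sub_pos.2 k1) hu0
        linarith))
    have t3 := (S2.psi_atTop.add (S2.phi_atTop.const_mul h)).eventually (lt_mem_nhds
      (show 1 - (1 - h) * vStar h k < vStar h k + h * uStar h k by
        have := mul_pos (sub_pos.2 h1) hv0
        linarith))
    obtain ⟨M, hM⟩ := eventually_atTop.1 (t1.and (t2.and t3))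
    refine ⟨max 0 M, le_max_left _ _, ?_, ?_, ?_⟩
    · intro t ht; exact (hM t (le_trans (le_max_right _ _) ht)).1
    · intro t ht; exact (hM t (le_trans (le_max_right _ _) ht)).2.1
    · intro t ht; exact (hM t (le_trans (le_max_right _ _) ht)).2.2
  -- extension from the compact interval
  have ext : ∀ τ, 0 ≤ τ → (∀ s ∈ Icc (-N) M, φ2 s ≤ φ1 (s + τ) ∧ ψ1 (s + τ) ≤ ψ2 s) →
      ∀ s, φ2 s ≤ φ1 (s + τ) ∧ ψ1 (s + τ) ≤ ψ2 s := by
    intro τ hτ hI s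
    rcases le_total s (-N) with hs | hs
    · refine ⟨?_, ?_⟩
      · rw [H2.z s (by linarith)]; exact H1.phi0 _
      · by_contra hcon
        push Not at hcon
        have hlim : Tendsto (fun s => ψ2 s - ψ1 (s + τ)) atBot (nhds 0) := by
          have := S2.psi_atBot.sub (S1.psi_atBot.comp (tendsto_atBot_add_const_right atBot τ tendsto_id))
          simpa using this
        have hz1 : ψ2 s - ψ1 (s + τ) < 0 := by linarith
        obtain ⟨R, hR1, hR2⟩ := ((hlim.eventually (lt_mem_nhds hz1)).and
          (eventually_le_atBot s)).exists
        have hend := (hI (-N) ⟨le_rfl, by linarith⟩).2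
        obtain ⟨s0, -, hs0, hle, hmin⟩ := end_min (f := fun s => ψ2 s - ψ1 (s + τ)) (by fun_prop)
          hR2 hs hR1 (by show ψ2 s - ψ1 (s + τ) < ψ2 (-N) - ψ1 (-N + τ); linarith)
        have hk2 := kpsi τ s0 hmin
        have hhalf := hN s0 hs0.le
        rw [H2.z s0 (by linarith)] at hk2
        have := mul_nonneg (psi1pos (s0 + τ)).le (mul_nonneg h0.le (H1.phi0 (s0 + τ)))
        have hlt : ψ2 s0 < ψ1 (s0 + τ) := by linarith
        nlinarith
    · rcases le_total s M with hsM | hsM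
      · exact hI s ⟨hs, hsM⟩
      · by_contra hcon
        have hzneg : min (φ1 (s + τ) - φ2 s) (ψ2 s - ψ1 (s + τ)) < 0 := by
          by_contra hc
          push Not at hc
          rw [le_min_iff] at hc
          exact hcon ⟨by linarith [hc.1], by linarith [hc.2]⟩
        have hshift := tendsto_atTop_add_const_right atTop τ (tendsto_id (α := ℝ))
        have hlim : Tendsto (fun s => min (φ1 (s + τ) - φ2 s) (ψ2 s - ψ1 (s + τ))) atTop (nhds 0) := by
          have l1 := (S1.phi_atTop.comp hshift).sub S2.phi_atTop
          have l2 := S2.psi_atTop.sub (S1.psi_atTop.comp hshift)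
          have := l1.min l2
          simpa using this
        obtain ⟨R, hR1, hR2⟩ := ((hlim.eventually (lt_mem_nhds hzneg)).and
          (eventually_ge_atTop s)).exists
        have hend := hI M ⟨by linarith, le_rfl⟩
        obtain ⟨s0, hs0, -, hle, hmin⟩ := end_min
          (f := fun s => min (φ1 (s + τ) - φ2 s) (ψ2 s - ψ1 (s + τ))) (by fun_prop)
          hsM hR2 (by
            refine lt_of_lt_of_le hzneg ?_
            exact le_min (by linarith [hend.1]) (by linarith [hend.2])) hR1
        have g1 := hM1 (s0 + τ) (by linarith)
        have g2 := hM2 s0 hs0.le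
        have g3 := hM3 s0 hs0.le
        have g4 := H1.psi0 (s0 + τ)
        have a0 := H1.phi0 (s0 + τ)
        have P0 := psi1pos (s0 + τ)
        rcases min_choice (φ1 (s0 + τ) - φ2 s0) (ψ2 s0 - ψ1 (s0 + τ)) with hch | hch
        · have hm : IsLocalMin (fun s => φ1 (s + τ) - φ2 s) s0 := by
            filter_upwards [hmin] with t ht
            rw [hch] at ht
            exact ht.trans (min_le_left _ _)
          have hk1 := kphi τ s0 hτ (by linarith) hm
          have hother : φ1 (s0 + τ) - φ2 s0 ≤ ψ2 s0 - ψ1 (s0 + τ) := by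
            rw [← hch]; exact min_le_right _ _
          rw [hch] at hle
          generalize φ1 (s0 + τ) = a at *
          generalize ψ1 (s0 + τ) = P at *
          generalize φ2 s0 = u at *
          generalize ψ2 s0 = v at *
          obtain ⟨ε, rfl⟩ : ∃ ε, u = a + ε := ⟨u - a, by ring⟩
          have hε : 0 < ε := by linarith
          have e1 : 0 ≤ a * (k * (v + ε - P)) := mul_nonneg a0 (mul_nonneg k0.le (by linarith))
          have e2 : 0 < ε * ((1 - (a + ε) - k * v) - (1 - k) * a) := by linarith
          have e3 := pos_of_mul_pos_right e2 hε.le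
          have e4 : (1 - k) * (uStar h k / 2) < (1 - k) * a :=
            mul_lt_mul_of_pos_left g1 (sub_pos.2 k1)
          linarith
        · have hm : IsLocalMin (fun s => ψ2 s - ψ1 (s + τ)) s0 := by
            filter_upwards [hmin] with t ht
            rw [hch] at ht
            exact ht.trans (min_le_right _ _)
          have hk1 := kpsi τ s0 hm
          have hother : ψ2 s0 - ψ1 (s0 + τ) ≤ φ1 (s0 + τ) - φ2 s0 := by
            rw [← hch]; exact min_le_left _ _
          rw [hch] at hle
          generalize φ1 (s0 + τ) = a at *
          generalize ψ1 (s0 + τ) = P at *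
          generalize φ2 s0 = u at *
          generalize ψ2 s0 = v at *
          obtain ⟨ε, rfl⟩ : ∃ ε, P = v + ε := ⟨P - v, by ring⟩
          have hε : 0 < ε := by linarith
          have e1 : 0 ≤ (v + ε) * (h * (a - u + ε)) := mul_nonneg P0.le (mul_nonneg h0.le (by linarith))
          have e2 : 0 < ε * (1 - (1 - h) * (v + ε) - v - h * u) := by linarith
          have e3 := pos_of_mul_pos_right e2 hε.le
          have e4 : (1 - h) * vStar h k ≤ (1 - h) * (v + ε) :=
            mul_le_mul_of_nonneg_left g4 (sub_pos.2 h1).le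
          linarith
  -- sliding
  set T : Set ℝ := {τ | 0 ≤ τ ∧ ∀ s, φ2 s ≤ φ1 (s + τ) ∧ ψ1 (s + τ) ≤ ψ2 s} with hT
  have hTne : T.Nonempty := by
    have b1 : φ2 M < uStar h k := by
      have := sm2 (mem_Ici.2 hM0) (mem_Ici.2 (by linarith : 0 ≤ M + 1)) (by linarith)
      exact this.trans_le (mono2.ge_of_tendsto S2.phi_atTop _)
    have b2 : vStar h k < ψ2 M :=
      lt_of_le_of_lt (H2.psi0 (M + 1)) (sa2 (by linarith))
    obtain ⟨T0, hT0⟩ := eventually_atTop.1 ((S1.phi_atTop.eventually (lt_mem_nhds b1)).and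
      (S1.psi_atTop.eventually (gt_mem_nhds b2)))
    refine ⟨max 0 T0 + N, by positivity, ?_⟩
    refine ext _ (by positivity) ?_
    intro s hs
    have hle : T0 ≤ s + (max 0 T0 + N) := by
      have := le_max_right 0 T0
      linarith [hs.1]
    obtain ⟨x1, x2⟩ := hT0 _ hle
    exact ⟨(mono2 hs.2).trans x1.le, x2.le.trans (sa2.antitone hs.2)⟩
  have hTbdd : BddBelow T := ⟨0, fun τ hτ => hτ.1⟩
  have hTcl : IsClosed T := by
    have : T = Ici 0 ∩ ⋂ s, ({τ | φ2 s ≤ φ1 (s + τ)} ∩ {τ | ψ1 (s + τ) ≤ ψ2 s}) := by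
      ext τ; simp [hT]
    rw [this]
    refine isClosed_Ici.inter (isClosed_iInter fun s => IsClosed.inter ?_ ?_)
    · exact isClosed_le continuous_const (by fun_prop)
    · exact isClosed_le (by fun_prop) continuous_const
  have hmem := hTcl.csInf_mem hTne hTbdd
  set τ := sInf T with hτ
  obtain ⟨hτ0, hord⟩ := hmem
  rcases hτ0.eq_or_lt with hz | hpos
  · intro s
    have := (hord s).1
    rwa [← hz, add_zero] at this
  · exfalso
    have st1 : ∀ s ∈ Icc 0 M, 0 < φ1 (s + τ) - φ2 s := by
      intro s hs
      rcases hs.1.eq_or_lt with rfl | hs0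
      · rw [H2.z 0 le_rfl, sub_zero]; exact pos1 _ (by linarith)
      · by_contra hcon
        have heq : φ1 (s + τ) = φ2 s := le_antisymm (by linarith) (hord s).1
        have := kphi τ s hτ0 hs0 (Eventually.of_forall fun t => by
          show φ1 (s + τ) - φ2 s ≤ φ1 (t + τ) - φ2 t
          linarith [(hord t).1])
        rw [heq] at this
        have e := mul_nonneg (H2.phi0 s) (mul_nonneg k0.le (sub_nonneg.2 (hord s).2))
        linarith
    have st2 : ∀ s ∈ Icc (-N) M, 0 < ψ2 s - ψ1 (s + τ) := by
      intro s hs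
      by_contra hcon
      have heq : ψ1 (s + τ) = ψ2 s := le_antisymm (hord s).2 (by linarith)
      have := kpsi τ s (Eventually.of_forall fun t => by
        show ψ2 s - ψ1 (s + τ) ≤ ψ2 t - ψ1 (t + τ)
        linarith [(hord t).2])
      rw [heq] at this
      have e := mul_nonneg (psi2pos s).le (mul_nonneg h0.le (sub_nonneg.2 (hord s).1))
      linarith
    have ev1 : ∀ᶠ t in nhds τ, ∀ s ∈ Icc 0 M, 0 < φ1 (s + t) - φ2 s := by
      apply isCompact_Icc.eventually_forall_of_forall_eventually
      intro s hs
      have hc : Continuous (fun x : ℝ × ℝ => φ1 (x.2 + x.1) - φ2 x.2) := by fun_prop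
      exact (hc.tendsto (τ, s)).eventually (lt_mem_nhds (st1 s hs))
    have ev2 : ∀ᶠ t in nhds τ, ∀ s ∈ Icc (-N) M, 0 < ψ2 s - ψ1 (s + t) := by
      apply isCompact_Icc.eventually_forall_of_forall_eventually
      intro s hs
      have hc : Continuous (fun x : ℝ × ℝ => ψ2 x.2 - ψ1 (x.2 + x.1)) := by fun_prop
      exact (hc.tendsto (τ, s)).eventually (lt_mem_nhds (st2 s hs))
    have ev := (ev1.and (ev2.and (lt_mem_nhds hpos))).filter_mono
      (nhdsWithin_le_nhds (s := Iio τ))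
    obtain ⟨t, ⟨t1, t2, t3⟩, t4⟩ := (ev.and self_mem_nhdsWithin).exists
    have htT : t ∈ T := by
      refine ⟨t3.le, ext t t3.le ?_⟩
      intro s hs
      refine ⟨?_, by linarith [t2 s hs]⟩
      rcases le_total s 0 with hs0 | hs0
      · rw [H2.z s hs0]; exact H1.phi0 _
      · linarith [t1 s ⟨hs0, hs.2⟩]
    have := csInf_le hTbdd htT
    exact absurd t4 (not_lt.2 this)

lemma ultra_lim (g : Ultrafilter ℕ) {u : ℕ → ℝ} {L : ℝ} (hu : ∀ i, |u i| ≤ L) :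
    ∃ x, Tendsto u (g : Filter ℕ) (nhds x) := by
  have hc : IsCompact (Icc (-L) L) := isCompact_Icc
  obtain ⟨x, -, hx⟩ := hc.ultrafilter_le_nhds (g.map u) (by
    rw [le_principal_iff]
    show u ⁻¹' Icc (-L) L ∈ (g : Filter ℕ)
    exact Filter.univ_mem' fun i => abs_le.1 (hu i))
  exact ⟨x, hx⟩

lemma conv_core {d r h k C : ℝ} (hd : 0 < d) (hr : 0 < r) (hC : 0 ≤ C)
    (hh : h ∈ Ioo (0:ℝ) 1) (hk : k ∈ Ioo (0:ℝ) 1)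
    {ci : ℕ → ℝ} {c : ℝ} (hci : ∀ i, 0 ≤ ci i ∧ ci i ≤ C)
    (hc : Tendsto ci atTop (nhds c)) {F Q Y P : ℕ → ℝ → ℝ} {φ q ψ p : ℝ → ℝ}
    (H : ∀ i, PreWave d r h k (ci i) (F i) (Q i) (Y i) (P i))
    (HT : PreWave d r h k c φ q ψ p)
    (hu : ∀ g : Ultrafilter ℕ, (g : Filter ℕ) ≤ atTop → ∀ φ' q' ψ' p' : ℝ → ℝ,
      PreWave d r h k c φ' q' ψ' p' →
      (∀ s, Tendsto (fun i => F i s) (g : Filter ℕ) (nhds (φ' s))) → φ' = φ ∧ ψ' = ψ) :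
    (∀ K : Set ℝ, IsCompact K → K ⊆ Ici 0 →
      TendstoUniformlyOn F φ atTop K ∧ TendstoUniformlyOn Q q atTop K ∧
      TendstoUniformlyOn (fun i s => ci i * Q i s - F i s * (1 - F i s - k * Y i s))
        (fun s => c * q s - φ s * (1 - φ s - k * ψ s)) atTop K) ∧
    (∀ K : Set ℝ, IsCompact K →
      TendstoUniformlyOn Y ψ atTop K ∧ TendstoUniformlyOn P p atTop K ∧
      TendstoUniformlyOn (fun i s => (ci i * P i s - r * Y i s * (1 - Y i s - h * F i s)) / d)
        (fun s => (c * p s - r * ψ s * (1 - ψ s - h * φ s)) / d) atTop K) := by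
  obtain ⟨L, hL, hb⟩ := pre_bounds hd hr hC hh hk
  have hb' := fun i => hb _ _ _ _ _ (hci i).1 (hci i).2 (H i)
  obtain ⟨-, -, hv0, -⟩ := star_facts hh hk
  have hUD : UniqueDiffOn ℝ (Ici (0:ℝ)) := uniqueDiffOn_Ici 0
  have key : ∀ g : Ultrafilter ℕ, (g : Filter ℕ) ≤ atTop →
      (∀ s, Tendsto (fun i => F i s) (g : Filter ℕ) (nhds (φ s))) ∧
      (∀ s ∈ Ici (0:ℝ), Tendsto (fun i => Q i s) (g : Filter ℕ) (nhds (q s))) ∧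
      (∀ s, Tendsto (fun i => Y i s) (g : Filter ℕ) (nhds (ψ s))) ∧
      (∀ s, Tendsto (fun i => P i s) (g : Filter ℕ) (nhds (p s))) := by
    intro g hg
    have x1 : ∀ s, ∃ x, Tendsto (fun i => F i s) (g : Filter ℕ) (nhds x) := fun s =>
      ultra_lim g (L := 1) fun i => abs_le.2 ⟨by linarith [(H i).phi0 s], (H i).phi1 s⟩
    have x2 : ∀ s, ∃ x, s ∈ Ici (0:ℝ) → Tendsto (fun i => Q i s) (g : Filter ℕ) (nhds x) := by
      intro s
      by_cases hs : s ∈ Ici (0:ℝ)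
      · obtain ⟨x, hx⟩ := ultra_lim g (u := fun i => Q i s) (L := L) fun i => (hb' i).1 s hs
        exact ⟨x, fun _ => hx⟩
      · exact ⟨0, fun h => absurd h hs⟩
    have x3 : ∀ s, ∃ x, Tendsto (fun i => Y i s) (g : Filter ℕ) (nhds x) := fun s =>
      ultra_lim g (L := 1) fun i => abs_le.2 ⟨by linarith [(H i).psi0 s], (H i).psi1 s⟩
    have x4 : ∀ s, ∃ x, Tendsto (fun i => P i s) (g : Filter ℕ) (nhds x) := fun s =>
      ultra_lim g (L := L) fun i => (hb' i).2.1 s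
    choose φ' hφ' using x1
    choose q' hq' using x2
    choose ψ' hψ' using x3
    choose p' hp' using x4
    have HP := pre_limit hd hr hC hh hk hci (hc.mono_left hg) H hφ' hq' hψ' hp'
    obtain ⟨rfl, rfl⟩ := hu g hg φ' q' ψ' p' HP hφ'
    refine ⟨hφ', ?_, hψ', ?_⟩
    · intro s hs
      have : q' s = q s := (hUD s hs).eq_deriv _ (HP.dphi s hs) (HT.dphi s hs)
      rw [← this]; exact hq' s hs
    · intro s
      have : p' s = p s := (HP.dpsi s).unique (HT.dpsi s)
      rw [← this]; exact hp' s
  have tF : ∀ s, Tendsto (fun i => F i s) atTop (nhds (φ s)) := fun s =>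
    (tendsto_iff_ultrafilter _ _ _).2 fun g hg => (key g hg).1 s
  have tQ : ∀ s ∈ Ici (0:ℝ), Tendsto (fun i => Q i s) atTop (nhds (q s)) := fun s hs =>
    (tendsto_iff_ultrafilter _ _ _).2 fun g hg => (key g hg).2.1 s hs
  have tY : ∀ s, Tendsto (fun i => Y i s) atTop (nhds (ψ s)) := fun s =>
    (tendsto_iff_ultrafilter _ _ _).2 fun g hg => (key g hg).2.2.1 s
  have tP : ∀ s, Tendsto (fun i => P i s) atTop (nhds (p s)) := fun s =>
    (tendsto_iff_ultrafilter _ _ _).2 fun g hg => (key g hg).2.2.2 s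
  constructor
  · intro K hK hKS
    refine ⟨unif_of_lip hL hK hKS (fun i => (hb' i).2.2.1) (fun s _ => tF s),
      unif_of_lip hL hK hKS (fun i => (hb' i).2.2.2.1) tQ,
      unif_of_lip hL hK hKS (fun i => (hb' i).2.2.2.2.1) ?_⟩
    intro s hs
    exact (hc.mul (tQ s hs)).sub
        ((tF s).mul (((tendsto_const_nhds).sub (tF s)).sub ((tY s).const_mul k)))
  · intro K hK
    refine ⟨unif_of_lip hL hK (subset_univ K) (fun i => (hb' i).2.2.2.2.2.1) (fun s _ => tY s),
      unif_of_lip hL hK (subset_univ K) (fun i => (hb' i).2.2.2.2.2.2.1) (fun s _ => tP s),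
      unif_of_lip hL hK (subset_univ K) (fun i => (hb' i).2.2.2.2.2.2.2) ?_⟩
    intro s _
    exact ((hc.mul (tP s)).sub (((tY s).const_mul r).mul
        (((tendsto_const_nhds).sub (tY s)).sub ((tF s).const_mul h)))).div_const d

lemma pre_second {d r h k c : ℝ} {φ ψ : ℝ → ℝ}
    (H : PreWave d r h k c φ (derivWithin φ (Ici 0)) ψ (deriv ψ)) :
    EqOn (fun s => c * derivWithin φ (Ici 0) s - φ s * (1 - φ s - k * ψ s))
      (derivWithin (derivWithin φ (Ici 0)) (Ici 0)) (Ici 0) ∧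
    (fun s => (c * deriv ψ s - r * ψ s * (1 - ψ s - h * φ s)) / d) = deriv (deriv ψ) :=
  ⟨fun s hs => ((H.dq s hs).derivWithin (uniqueDiffOn_Ici 0 s hs)).symm,
    funext fun s => ((H.dp s).deriv).symm⟩

lemma pre_trivial {d r h k c : ℝ} (hh : h ∈ Ioo (0:ℝ) 1) (hk : k ∈ Ioo (0:ℝ) 1) :
    PreWave d r h k c (fun _ => 0) (fun _ => 0) (fun _ => 1) (fun _ => 0) := by
  obtain ⟨-, -, hv0, hv1, -⟩ := star_facts hh hk
  refine ⟨fun _ _ => rfl, fun s _ => hasDerivWithinAt_const _ _ _, fun s _ => ?_,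
    fun s => hasDerivAt_const _ _, fun s => ?_, fun _ _ => le_rfl, fun _ => le_rfl,
    fun _ => le_rfl, fun _ => zero_le_one, fun _ => hv1.le, fun _ => le_rfl⟩
  · simpa using hasDerivWithinAt_const s (Ici (0:ℝ)) (0:ℝ)
  · simpa using hasDerivAt_const s (0:ℝ)

theorem stmt11 (d r h k cs : ℝ) (hd : 0 < d) (hr : 0 < r)
    (hh : h ∈ Set.Ioo (0:ℝ) 1) (hk : k ∈ Set.Ioo (0:ℝ) 1) (hcs : 0 < cs)
    -- a semi-wave with speed `c ≥ 0` exists iff `c < cs`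
    (hiff : ∀ c : ℝ, 0 ≤ c → ((∃ φ ψ : ℝ → ℝ, IsSemiWave d r h k c φ ψ) ↔ c < cs))
    -- `(Φ c, Ψ c)` is the unique semi-wave with speed `c ∈ [0, cs)`
    (Φ Ψ : ℝ → ℝ → ℝ)
    (hsw : ∀ c : ℝ, 0 ≤ c → c < cs → IsSemiWave d r h k c (Φ c) (Ψ c))
    (huniq : ∀ c : ℝ, 0 ≤ c → c < cs →
      ∀ φ ψ : ℝ → ℝ, IsSemiWave d r h k c φ ψ → φ = Φ c ∧ ψ = Ψ c) :
    -- (i) continuity of `c ↦ (Φ c, Ψ c)` in `C²_loc([0,∞)) × C²_loc(ℝ)`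
    (∀ ci : ℕ → ℝ, (∀ i, 0 ≤ ci i ∧ ci i < cs) →
      ∀ chat : ℝ, 0 ≤ chat → chat < cs →
      Filter.Tendsto ci Filter.atTop (nhds chat) →
      ((∀ K : Set ℝ, IsCompact K → K ⊆ Set.Ici 0 →
        TendstoUniformlyOn (fun i => Φ (ci i)) (Φ chat) Filter.atTop K ∧
        TendstoUniformlyOn (fun i => derivWithin (Φ (ci i)) (Set.Ici 0))
          (derivWithin (Φ chat) (Set.Ici 0)) Filter.atTop K ∧
        TendstoUniformlyOn
          (fun i => derivWithin (derivWithin (Φ (ci i)) (Set.Ici 0)) (Set.Ici 0))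
          (derivWithin (derivWithin (Φ chat) (Set.Ici 0)) (Set.Ici 0))
          Filter.atTop K) ∧
      (∀ K : Set ℝ, IsCompact K →
        TendstoUniformlyOn (fun i => Ψ (ci i)) (Ψ chat) Filter.atTop K ∧
        TendstoUniformlyOn (fun i => deriv (Ψ (ci i))) (deriv (Ψ chat))
          Filter.atTop K ∧
        TendstoUniformlyOn (fun i => deriv (deriv (Ψ (ci i))))
          (deriv (deriv (Ψ chat))) Filter.atTop K))) ∧
    -- (ii) behaviour as `c → cs⁻`: `(Φ c, Ψ c) → (0, 1)` in `C²_loc([0,∞)) × C²_loc(ℝ)`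
    (∀ ci : ℕ → ℝ, (∀ i, 0 ≤ ci i ∧ ci i < cs) →
      Filter.Tendsto ci Filter.atTop (nhds cs) →
      ((∀ K : Set ℝ, IsCompact K → K ⊆ Set.Ici 0 →
        TendstoUniformlyOn (fun i => Φ (ci i)) (fun _ => 0) Filter.atTop K ∧
        TendstoUniformlyOn (fun i => derivWithin (Φ (ci i)) (Set.Ici 0))
          (fun _ => 0) Filter.atTop K ∧
        TendstoUniformlyOn
          (fun i => derivWithin (derivWithin (Φ (ci i)) (Set.Ici 0)) (Set.Ici 0))
          (fun _ => 0) Filter.atTop K) ∧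
      (∀ K : Set ℝ, IsCompact K →
        TendstoUniformlyOn (fun i => Ψ (ci i)) (fun _ => 1) Filter.atTop K ∧
        TendstoUniformlyOn (fun i => deriv (Ψ (ci i))) (fun _ => 0)
          Filter.atTop K ∧
        TendstoUniformlyOn (fun i => deriv (deriv (Ψ (ci i)))) (fun _ => 0)
          Filter.atTop K))) := by
  constructor
  · intro ci hci chat hch0 hch hlim
    have H := fun i => semi_pre hd hh hk (hsw (ci i) (hci i).1 (hci i).2)
    have HT := semi_pre hd hh hk (hsw chat hch0 hch)
    obtain ⟨ct, hct1, hct2⟩ := exists_between hch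
    have hct0 : 0 ≤ ct := hch0.trans hct1.le
    have St := hsw ct hct0 hct2
    have hpos : 0 < Φ ct 1 := by
      have hm : StrictMonoOn (Φ ct) (Ici 0) := by
        apply strictMonoOn_of_deriv_pos (convex_Ici 0) St.cont_phi.continuousOn
        intro s hs
        rw [interior_Ici] at hs
        exact St.phi_deriv_pos s hs
      have := hm (mem_Ici.2 le_rfl) (mem_Ici.2 zero_le_one) zero_lt_one
      rwa [St.phi_zero 0 le_rfl] at this
    obtain ⟨A, B⟩ := conv_core hd hr hcs.le hh hk (fun i => ⟨(hci i).1, (hci i).2.le⟩) hlim H HT (by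
      intro g hg φ' q' ψ' p' HP hφ'
      rcases dichotomy hd hr hch0 hh hk HP with ⟨hz, -⟩ | hS
      · exfalso
        have hge : Φ ct 1 ≤ φ' 1 := by
          refine ge_of_tendsto (hφ' 1) ?_
          filter_upwards [hg (hlim.eventually (gt_mem_nhds hct1))] with i hi
          exact semi_mono hd hr hi hh hk (hsw (ci i) (hci i).1 (hci i).2) St 1
        rw [hz 1] at hge
        linarith
      · exact huniq chat hch0 hch φ' ψ' hS)
    constructor
    · intro K hK hKS
      obtain ⟨a1, a2, a3⟩ := A K hK hKS
      refine ⟨a1, a2, ?_⟩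
      exact (a3.congr (Eventually.of_forall fun i => (pre_second (H i)).1.mono hKS)).congr_right
        ((pre_second HT).1.mono hKS)
    · intro K hK
      obtain ⟨a1, a2, a3⟩ := B K hK
      refine ⟨a1, a2, ?_⟩
      rw [(pre_second HT).2] at a3
      exact a3.congr (Eventually.of_forall fun i s _ => congrFun (pre_second (H i)).2 s)
  · intro ci hci hlim
    have H := fun i => semi_pre hd hh hk (hsw (ci i) (hci i).1 (hci i).2)
    obtain ⟨A, B⟩ := conv_core hd hr hcs.le hh hk (fun i => ⟨(hci i).1, (hci i).2.le⟩) hlim H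
      (pre_trivial hh hk) (by
      intro g hg φ' q' ψ' p' HP hφ'
      rcases dichotomy hd hr hcs.le hh hk HP with ⟨hz, hz'⟩ | hS
      · exact ⟨funext hz, funext hz'⟩
      · exact absurd ((hiff cs hcs.le).1 ⟨φ', ψ', hS⟩) (lt_irrefl _))
    constructor
    · intro K hK hKS
      obtain ⟨a1, a2, a3⟩ := A K hK hKS
      refine ⟨a1, a2, ?_⟩
      refine (a3.congr (Eventually.of_forall fun i => (pre_second (H i)).1.mono hKS)).congr_right ?_
      intro s _
      simp
    · intro K hK
      obtain ⟨a1, a2, a3⟩ := B K hK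
      refine ⟨a1, a2, ?_⟩
      refine (a3.congr (Eventually.of_forall fun i s _ => congrFun (pre_second (H i)).2 s)).congr_right ?_
      intro s _
      simp
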